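/- arXiv:1803.09479 — 4 statements merged into one kernel-verified Lean document; each statement's English description precedes it below -/
import Mathlib

section
/- Fix θ > 0, θ' > 0 with θ ≠ θ' and h > 0, and set c = coth(π θ' h). Then ∫_ℝ (θ/(θ² + ω²)) · (1 − F_{θ'}(ω)/S_{θ',h}(ω)) dω = π − (1/(π h c)) · [ π/(θ + θ') + (c² − 1) · (π/(2(θ + θ'))) · (1 − (θ·exp(−2π h θ') − θ'·exp(−2π h θ))/(θ − θ')) ], where F_{θ'}(ω) = θ'/(θ'² + ω²) and S_{θ',h}(ω) = ∑_{k ∈ ℤ} F_{θ'}(ω + k/h). -/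
open Real MeasureTheory

/-- The real hyperbolic cotangent. -/
noncomputable def coth (x : ℝ) : ℝ := Real.cosh x / Real.sinh x

lemma im_pi_cot (x y : ℝ) (hy : 0 < y) :
    ((π : ℂ) * Complex.cot (π * (x + y * Complex.I))).im =
      - (π * (sinh (π * y) * cosh (π * y)) / (sinh (π * y) ^ 2 + sin (π * x) ^ 2)) := by
  have e : (π : ℂ) * (x + y * Complex.I) = ((π * x : ℝ) : ℂ) + ((π * y : ℝ) : ℂ) * Complex.I := by
    push_cast; ring
  have hs : 0 < sinh (π * y) := Real.sinh_pos_iff.2 (by positivity)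
  have hpos : 0 < sinh (π * y) ^ 2 + sin (π * x) ^ 2 := by positivity
  rw [e, Complex.cot, Complex.sin_add_mul_I, Complex.cos_add_mul_I]
  simp only [← Complex.ofReal_sin, ← Complex.ofReal_cos, ← Complex.ofReal_sinh,
    ← Complex.ofReal_cosh]
  generalize π * x = a at *
  generalize π * y = b at *
  have hc := Real.cosh_sq b
  have hsc := Real.sin_sq_add_cos_sq a
  generalize sin a = S at *
  generalize cos a = C at *
  generalize sinh b = sh at *
  generalize cosh b = ch at *
  have hn : Complex.normSq ((S : ℂ) * (ch : ℂ) + (C : ℂ) * (sh : ℂ) * Complex.I)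
      = sh ^ 2 + S ^ 2 := by
    simp only [Complex.normSq_apply]
    simp
    linear_combination S ^ 2 * hc + sh ^ 2 * hsc
  rw [Complex.im_ofReal_mul, Complex.div_im, hn]
  simp
  field_simp
  linear_combination (- ch) * hsc

lemma hasSum_lattice (x y : ℝ) (hy : 0 < y) :
    ∑' k : ℤ, y / (y ^ 2 + (x + (k : ℝ)) ^ 2) =
      π * (sinh (π * y) * cosh (π * y)) / (sinh (π * y) ^ 2 + sin (π * x) ^ 2) := by
  set z : ℂ := x + y * Complex.I with hz
  have hzm : z ∈ Complex.integerComplement := by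
    rintro ⟨n, hn⟩
    have := congrArg Complex.im hn
    simp [hz] at this
    linarith
  have hS := (summable_cotTerm hzm).hasSum
  have hT : ∑' n, cotTerm z n = π * Complex.cot (π * z) - 1 / z := (cot_series_rep' hzm).symm
  rw [hT] at hS
  have hI := ((Complex.hasSum_iff _ _).1 hS).2
  set f : ℤ → ℝ := fun k => y / (y ^ 2 + (x + (k : ℝ)) ^ 2) with hf
  have him : ∀ t : ℝ, (1 / (z + t)).im = - (y / (y ^ 2 + (x + t) ^ 2)) := by
    intro t
    rw [one_div, Complex.inv_im]
    simp [hz, Complex.normSq_apply]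
    ring
  have hfun : ∀ n : ℕ, (cotTerm z n).im = - (f (n + 1) + f (-(n + 1))) := by
    intro n
    have h1 := him (n + 1)
    have h2 := him (-(n + 1))
    push_cast at h1 h2
    rw [← sub_eq_add_neg] at h2
    simp only [cotTerm, Complex.add_im, h1, h2, hf]
    push_cast
    ring
  have hI2 : HasSum (fun n : ℕ => f (n + 1) + f (-(n + 1)))
      (-(π * Complex.cot (π * z) - 1 / z).im) := by
    have := hI.neg
    simpa only [hfun, neg_neg] using this
  have hpos : ∀ k, 0 ≤ f k := fun k => by simp only [hf]; positivity
  have s1 : Summable fun n : ℕ => f (n + 1) :=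
    Summable.of_nonneg_of_le (fun n => hpos _) (fun n => by have := hpos (-(n+1)); linarith)
      hI2.summable
  have s2 : Summable fun n : ℕ => f (-(n + 1)) :=
    Summable.of_nonneg_of_le (fun n => hpos _) (fun n => by have := hpos (n+1); linarith)
      hI2.summable
  have h0 := him 0
  rw [tsum_of_add_one_of_neg_add_one s1 s2, add_right_comm, ← s1.tsum_add s2, hI2.tsum_eq,
    Complex.sub_im, hz, im_pi_cot x y hy, ← hz]
  simp only [Complex.ofReal_zero, add_zero] at h0
  rw [h0]
  simp [hf]

lemma integrable_F (a : ℝ) (ha : 0 < a) : Integrable fun w : ℝ => a / (a ^ 2 + w ^ 2) := by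
  have h := (integrable_inv_one_add_sq.comp_div (R := a) ha.ne').const_mul (1 / a)
  refine h.congr (.of_forall fun w => ?_)
  simp only
  field_simp

lemma integrable_exp_abs' (a : ℝ) (ha : 0 < a) :
    Integrable fun v : ℝ => Real.exp (-(a * |v|)) := by
  rw [← integrableOn_univ, ← Set.Iic_union_Ioi (a := (0 : ℝ))]
  refine IntegrableOn.union ?_ ?_
  · refine (integrableOn_exp_mul_Iic ha 0).congr_fun (fun v hv => ?_) measurableSet_Iic
    simp only [abs_of_nonpos (Set.mem_Iic.1 hv)]; ring_nf
  · refine (integrableOn_exp_mul_Ioi (neg_neg_of_pos ha) 0).congr_fun (fun v hv => ?_)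
      measurableSet_Ioi
    simp only [abs_of_pos (Set.mem_Ioi.1 hv)]; ring_nf

open FourierTransform in
lemma fourier_exp_abs (a : ℝ) (ha : 0 < a) (w : ℝ) :
    𝓕 (fun v : ℝ => ((Real.exp (-(2 * π * a * |v|)) : ℝ) : ℂ)) w =
      ((1 / π * (a / (a ^ 2 + w ^ 2)) : ℝ) : ℂ) := by
  have hi : Integrable fun v : ℝ => Complex.exp (↑(-2 * π * v * w) * Complex.I) •
      ((Real.exp (-(2 * π * a * |v|)) : ℝ) : ℂ) := by
    refine (integrable_exp_abs' (2 * π * a) (by positivity)).mono' ?_ (.of_forall fun v => ?_)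
    · exact Continuous.aestronglyMeasurable (by fun_prop)
    · rw [norm_smul, Complex.norm_exp_ofReal_mul_I, Complex.norm_real, one_mul,
        Real.norm_of_nonneg (Real.exp_pos _).le]
  have hp : 0 < 2 * π * a := by positivity
  rw [Real.fourier_real_eq_integral_exp_smul, ← setIntegral_univ,
    ← Set.Iic_union_Ioi (a := (0 : ℝ)),
    setIntegral_union (Set.Iic_disjoint_Ioi le_rfl) measurableSet_Ioi hi.integrableOn
      hi.integrableOn]
  have e1 : ∫ v : ℝ in Set.Iic 0, Complex.exp (↑(-2 * π * v * w) * Complex.I) •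
      ((Real.exp (-(2 * π * a * |v|)) : ℝ) : ℂ) =
      ∫ v : ℝ in Set.Iic 0, Complex.exp ((2 * π * a - 2 * π * w * Complex.I) * v) := by
    refine setIntegral_congr_fun measurableSet_Iic (fun v hv => ?_)
    simp only [abs_of_nonpos (Set.mem_Iic.1 hv), smul_eq_mul, Complex.ofReal_exp,
      ← Complex.exp_add]
    congr 1; push_cast; ring
  have e2 : ∫ v : ℝ in Set.Ioi 0, Complex.exp (↑(-2 * π * v * w) * Complex.I) •
      ((Real.exp (-(2 * π * a * |v|)) : ℝ) : ℂ) =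
      ∫ v : ℝ in Set.Ioi 0, Complex.exp ((-(2 * π * a) - 2 * π * w * Complex.I) * v) := by
    refine setIntegral_congr_fun measurableSet_Ioi (fun v hv => ?_)
    simp only [abs_of_pos (Set.mem_Ioi.1 hv), smul_eq_mul, Complex.ofReal_exp,
      ← Complex.exp_add]
    congr 1; push_cast; ring
  have r1 : 0 < (2 * π * a - 2 * π * w * Complex.I : ℂ).re := by simpa using hp
  have r2 : (-(2 * π * a) - 2 * π * w * Complex.I : ℂ).re < 0 := by simpa using hp
  rw [e1, e2, integral_exp_mul_complex_Iic r1, integral_exp_mul_complex_Ioi r2]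
  have n1 : (2 * π * a - 2 * π * w * Complex.I : ℂ) ≠ 0 := fun h => by simp [h] at r1
  have n2 : (-(2 * π * a) - 2 * π * w * Complex.I : ℂ) ≠ 0 := fun h => by simp [h] at r2
  have n3 : ((a : ℂ) ^ 2 + (w : ℂ) ^ 2) ≠ 0 := by
    have : a ^ 2 + w ^ 2 ≠ 0 := by positivity
    exact_mod_cast this
  have n4 : (π : ℂ) ≠ 0 := by exact_mod_cast Real.pi_ne_zero
  push_cast
  simp only [mul_zero, Complex.exp_zero]
  rw [div_add_div _ _ n1 n2, mul_comm, div_mul_div_comm, mul_one,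
    div_eq_div_iff (mul_ne_zero n1 n2) (mul_ne_zero n4 n3)]
  linear_combination (-4 * π ^ 2 * w ^ 2 * a : ℂ) * Complex.I_sq

open FourierTransform in
lemma integral_cos_F (a t : ℝ) (ha : 0 < a) (ht : 0 ≤ t) :
    ∫ w : ℝ, Real.cos (2 * π * t * w) * (a / (a ^ 2 + w ^ 2)) =
      π * Real.exp (-(2 * π * t * a)) := by
  have hF := funext (fourier_exp_abs a ha)
  have h1 : Integrable (fun v : ℝ => ((Real.exp (-(2 * π * a * |v|)) : ℝ) : ℂ)) :=
    (integrable_exp_abs' (2 * π * a) (by positivity)).ofReal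
  have h2 : Integrable (fun w : ℝ => ((1 / π * (a / (a ^ 2 + w ^ 2)) : ℝ) : ℂ)) :=
    ((integrable_F a ha).const_mul (1 / π)).ofReal
  have hinv := congrFun (Continuous.fourierInv_fourier_eq (by fun_prop) h1 (by rw [hF]; exact h2)) t
  rw [hF, Real.fourierInv_eq'] at hinv
  have hi : Integrable fun w : ℝ => Complex.exp ((↑(2 * π * inner ℝ w t) * Complex.I)) •
      ((1 / π * (a / (a ^ 2 + w ^ 2)) : ℝ) : ℂ) := by
    refine h2.norm.mono' ?_ (.of_forall fun v => ?_)
    · have hm : AEStronglyMeasurable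
          (fun w : ℝ => Complex.exp ((↑(2 * π * inner ℝ w t) * Complex.I))) volume :=
        Continuous.aestronglyMeasurable (by fun_prop)
      exact hm.mul h2.aestronglyMeasurable
    · rw [norm_smul, Complex.norm_exp_ofReal_mul_I, one_mul]
  have hre := congrArg Complex.re hinv
  rw [← RCLike.re_to_complex, ← integral_re hi] at hre
  have : ∀ w : ℝ, RCLike.re (Complex.exp ((↑(2 * π * inner ℝ w t) * Complex.I)) •
      ((1 / π * (a / (a ^ 2 + w ^ 2)) : ℝ) : ℂ)) =
      1 / π * (Real.cos (2 * π * t * w) * (a / (a ^ 2 + w ^ 2))) := by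
    intro w
    rw [smul_eq_mul, RCLike.re_to_complex, Complex.re_mul_ofReal, Complex.exp_ofReal_mul_I_re]
    simp only [RCLike.inner_apply, conj_trivial]
    rw [show 2 * π * (t * w) = 2 * π * t * w by ring]
    ring
  simp_rw [this] at hre
  rw [integral_const_mul, Complex.ofReal_re, abs_of_nonneg ht] at hre
  rw [one_div, inv_mul_eq_iff_eq_mul₀ Real.pi_ne_zero] at hre
  rw [hre]; ring_nf

lemma integral_combo (f g u v : ℝ → ℝ) (p q m n : ℝ) (hf : Integrable f) (hg : Integrable g)
    (hu : Integrable u) (hv : Integrable v) :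
    ∫ w, (f w - p * (m * g w - n * f w) + q * (m * u w - n * v w)) =
      (∫ w, f w) - p * (m * (∫ w, g w) - n * ∫ w, f w) + q * (m * (∫ w, u w) - n * ∫ w, v w) := by
  have k1 : Integrable fun w => m * g w - n * f w := (hg.const_mul m).sub (hf.const_mul n)
  have k2 : Integrable fun w => m * u w - n * v w := (hu.const_mul m).sub (hv.const_mul n)
  have k3 : Integrable fun w => f w - p * (m * g w - n * f w) := hf.sub (k1.const_mul p)
  rw [integral_add k3 (k2.const_mul q), integral_sub hf (k1.const_mul p), integral_const_mul,
    integral_const_mul, integral_sub (hg.const_mul m) (hf.const_mul n),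
    integral_sub (hu.const_mul m) (hv.const_mul n)]
  simp only [integral_const_mul]

/-- Closed form of the misspecified interpolation error for the exponential
(Matérn `ν = 1/2`) spectral density: for `θ, θ' > 0`, `θ ≠ θ'`, `h > 0`, with
`c = coth(π θ' h)`,
`∫ (θ/(θ² + ω²))·(1 − F_{θ'}(ω)/S_{θ',h}(ω)) dω
  = π − (1/(πhc))·[π/(θ+θ') + (c² − 1)·(π/(2(θ+θ')))·(1 − (θe^{−2πhθ'} − θ'e^{−2πhθ})/(θ − θ'))]`,
where `F_{θ'}(ω) = θ'/(θ'² + ω²)` and `S_{θ',h}(ω) = ∑_{k ∈ ℤ} F_{θ'}(ω + k/h)`. -/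
theorem misspecified_interpolation_error_closed_form (θ θ' h : ℝ)
    (hθ : 0 < θ) (hθ' : 0 < θ') (hne : θ ≠ θ') (hh : 0 < h) :
    ∫ ω : ℝ, θ / (θ ^ 2 + ω ^ 2) *
        (1 - (θ' / (θ' ^ 2 + ω ^ 2)) / ∑' k : ℤ, θ' / (θ' ^ 2 + (ω + (k : ℝ) / h) ^ 2)) =
      π - 1 / (π * h * coth (π * θ' * h)) *
        (π / (θ + θ') + (coth (π * θ' * h) ^ 2 - 1) * (π / (2 * (θ + θ'))) *
          (1 - (θ * Real.exp (-(2 * π * h * θ')) - θ' * Real.exp (-(2 * π * h * θ)))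
            / (θ - θ'))) := by
  have hs : 0 < sinh (π * θ' * h) := Real.sinh_pos_iff.2 (by positivity)
  have hcpos : 0 < cosh (π * θ' * h) := Real.cosh_pos _
  have hpi := Real.pi_pos
  have hsum : ∀ ω : ℝ, ∑' k : ℤ, θ' / (θ' ^ 2 + (ω + (k : ℝ) / h) ^ 2) =
      π * h * (sinh (π * θ' * h) * cosh (π * θ' * h)) /
        (sinh (π * θ' * h) ^ 2 + sin (π * h * ω) ^ 2) := by
    intro ω
    have := hasSum_lattice (h * ω) (h * θ') (by positivity)
    rw [show π * (h * θ') = π * θ' * h by ring, show π * (h * ω) = π * h * ω by ring] at this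
    have e : ∀ k : ℤ, θ' / (θ' ^ 2 + (ω + (k : ℝ) / h) ^ 2) =
        h * ((h * θ') / ((h * θ') ^ 2 + (h * ω + (k : ℝ)) ^ 2)) := by
      intro k
      have : (h * θ') ^ 2 + (h * ω + (k : ℝ)) ^ 2 = h ^ 2 * (θ' ^ 2 + (ω + (k : ℝ) / h) ^ 2) := by
        field_simp
      have h0 : 0 < θ' ^ 2 + (ω + (k : ℝ) / h) ^ 2 := by positivity
      rw [this]
      generalize θ' ^ 2 + (ω + (k : ℝ) / h) ^ 2 = D at *
      field_simp
    simp_rw [e]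
    rw [tsum_mul_left, this]
    ring
  have hd : θ ^ 2 - θ' ^ 2 ≠ 0 := by
    rw [sq_sub_sq]
    exact mul_ne_zero (by positivity) (sub_ne_zero.2 hne)
  set s := sinh (π * θ' * h) with hsdef
  set c := cosh (π * θ' * h) with hcdef
  have hcs : c ^ 2 = s ^ 2 + 1 := Real.cosh_sq _
  have hint : ∀ (a : ℝ), 0 < a → Integrable fun w : ℝ =>
      Real.cos (2 * π * h * w) * (a / (a ^ 2 + w ^ 2)) := by
    intro a ha
    refine (integrable_F a ha).mono' ?_ (.of_forall fun v => ?_)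
    · refine AEStronglyMeasurable.mul ?_ (integrable_F a ha).aestronglyMeasurable
      exact Continuous.aestronglyMeasurable (by fun_prop)
    · rw [norm_mul, Real.norm_of_nonneg (by positivity : 0 ≤ a / (a ^ 2 + v ^ 2))]
      exact mul_le_of_le_one_left (by positivity) (Real.abs_cos_le_one _)
  have hint0 : ∀ a : ℝ, 0 < a → ∫ w : ℝ, a / (a ^ 2 + w ^ 2) = π := by
    intro a ha
    simpa using integral_cos_F a 0 ha le_rfl
  have key : ∀ ω : ℝ, θ / (θ ^ 2 + ω ^ 2) *
        (1 - (θ' / (θ' ^ 2 + ω ^ 2)) / ∑' k : ℤ, θ' / (θ' ^ 2 + (ω + (k : ℝ) / h) ^ 2)) =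
      θ / (θ ^ 2 + ω ^ 2)
      - (1 / (π * h * s * c * (θ ^ 2 - θ' ^ 2)) * (s ^ 2 + 1 / 2)) *
        (θ * (θ' / (θ' ^ 2 + ω ^ 2)) - θ' * (θ / (θ ^ 2 + ω ^ 2)))
      + (1 / (π * h * s * c * (θ ^ 2 - θ' ^ 2)) * (1 / 2)) *
        (θ * (Real.cos (2 * π * h * ω) * (θ' / (θ' ^ 2 + ω ^ 2)))
          - θ' * (Real.cos (2 * π * h * ω) * (θ / (θ ^ 2 + ω ^ 2)))) := by
    intro ω
    rw [hsum ω, Real.sin_sq_eq_half_sub, show 2 * (π * h * ω) = 2 * π * h * ω by ring]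
    have hq : 0 < s ^ 2 + (1 / 2 - Real.cos (2 * π * h * ω) / 2) := by
      have := Real.cos_le_one (2 * π * h * ω)
      have : 0 < s ^ 2 := by positivity
      linarith
    generalize Real.cos (2 * π * h * ω) = C at *
    have d1 : θ ^ 2 + ω ^ 2 ≠ 0 := by positivity
    have d2 : θ' ^ 2 + ω ^ 2 ≠ 0 := by positivity
    have hq' := hq.ne'
    have pf : θ * (θ' / (θ' ^ 2 + ω ^ 2)) - θ' * (θ / (θ ^ 2 + ω ^ 2)) =
        (θ ^ 2 - θ' ^ 2) * (θ / (θ ^ 2 + ω ^ 2) * (θ' / (θ' ^ 2 + ω ^ 2))) := by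
      field_simp
      ring
    have pf2 : θ * (C * (θ' / (θ' ^ 2 + ω ^ 2))) - θ' * (C * (θ / (θ ^ 2 + ω ^ 2))) =
        C * ((θ ^ 2 - θ' ^ 2) * (θ / (θ ^ 2 + ω ^ 2) * (θ' / (θ' ^ 2 + ω ^ 2)))) := by
      rw [← pf]; ring
    rw [pf, pf2]
    generalize θ / (θ ^ 2 + ω ^ 2) = A at *
    generalize θ' / (θ' ^ 2 + ω ^ 2) = B at *
    generalize θ ^ 2 - θ' ^ 2 = D at *
    rw [div_div_eq_mul_div]
    field_simp
    ring
  simp_rw [key]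
  have i1 := integrable_F θ hθ
  have i2 := integrable_F θ' hθ'
  have j1 := hint θ hθ
  have j2 := hint θ' hθ'
  rw [integral_combo _ _ _ _ _ _ _ _ i1 i2 j2 j1,
    hint0 θ hθ, hint0 θ' hθ', integral_cos_F θ h hθ hh.le, integral_cos_F θ' h hθ' hh.le]
  simp only [coth]
  rw [← hsdef, ← hcdef]
  generalize Real.exp (-(2 * π * h * θ)) = E1
  generalize Real.exp (-(2 * π * h * θ')) = E2
  have hsub := sub_ne_zero.2 hne
  have hadd : θ + θ' ≠ 0 := by positivity
  have hc2 : (c / s) ^ 2 - 1 = 1 / s ^ 2 := by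
    rw [div_pow, hcs]; field_simp; ring
  rw [hc2, sq_sub_sq]
  field_simp
  ring
end

section
/- Fix θ > 0 and h > 0, and set c = coth(π θ h). Then ∫_ℝ (θ/(θ² + ω²)) · (1 − F_θ(ω)/S_{θ,h}(ω)) dω = π − (1/(π h c)) · [ π/(2θ) + (c² − 1) · (π/(4θ)) · (1 − exp(−2π h θ)·(1 + 2π h θ)) ], where F_θ(ω) = θ/(θ² + ω²) and S_{θ,h}(ω) = ∑_{k ∈ ℤ} F_θ(ω + k/h). -/
open Real MeasureTheory

theorem S_closed_aux (x a : ℝ) (ha : 0 < a) :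
    ∑' k : ℤ, a / (a ^ 2 + (x + (k : ℝ)) ^ 2) =
      π * (Real.sinh (π * a) * Real.cosh (π * a)) / (Real.sinh (π * a) ^ 2 + Real.sin (π * x) ^ 2) := by
  set z : ℂ := ⟨x, a⟩ with hz
  have hzm : z ∈ Complex.integerComplement := by
    rw [Complex.mem_integerComplement_iff]
    rintro ⟨n, hn⟩
    have := congrArg Complex.im hn
    simp [hz] at this
    exact ha.ne this
  have key : ∀ r : ℝ, (1 / (z + r)).im = -(a / (a ^ 2 + (x + r) ^ 2)) := by
    intro r
    rw [one_div, Complex.inv_im]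
    simp [hz, Complex.normSq_apply]
    rw [← neg_div]; congr 1; ring
  set f : ℤ → ℝ := fun k => a / (a ^ 2 + (x + (k : ℝ)) ^ 2) with hf
  have hfpos : ∀ k, 0 ≤ f k := fun k => by positivity
  have hs := Complex.imCLM.hasSum (summable_cotTerm hzm).hasSum
  have hs' : HasSum (fun n : ℕ => f (n + 1) + f (-(n + 1))) (-((π * Complex.cot (π * z) - 1 / z).im)) := by
    rw [cot_series_rep' hzm]
    have hn := hs.neg
    have heq : (fun n : ℕ => f (n + 1) + f (-(n + 1))) = fun n : ℕ => -Complex.imCLM (cotTerm z n) := by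
      funext n
      have g1 : (1 / (z + ((n : ℂ) + 1))).im = -f (n + 1) := by
        have := key (n + 1)
        push_cast at this
        rw [this]; simp [hf]
      have g2 : (1 / (z - ((n : ℂ) + 1))).im = -f (-(n + 1)) := by
        have := key (-(n + 1))
        push_cast at this
        rw [sub_eq_add_neg, this]; simp [hf]
      simp only [cotTerm, Complex.imCLM_apply, Complex.add_im, g1, g2]
      ring
    rw [heq]
    exact hn
  have h1 : Summable (fun n : ℕ => f (n + 1)) :=
    Summable.of_nonneg_of_le (fun n => hfpos _) (fun n => le_add_of_nonneg_right (hfpos _)) hs'.summable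
  have h2 : Summable (fun n : ℕ => f (-(n + 1))) :=
    Summable.of_nonneg_of_le (fun n => hfpos _) (fun n => le_add_of_nonneg_left (hfpos _)) hs'.summable
  rw [tsum_of_add_one_of_neg_add_one h1 h2]
  have h3 := hs'.tsum_eq
  rw [h1.tsum_add h2] at h3
  have h0 := key 0
  have hf0 : f 0 = a / (a ^ 2 + (x + 0) ^ 2) := by simp [hf]
  rw [← hf0] at h0
  simp only [Complex.ofReal_zero, add_zero] at h0
  rw [Complex.sub_im, h0] at h3
  have h4 : ∑' n : ℕ, f (n + 1) + f 0 + ∑' n : ℕ, f (-(n + 1)) = -(π * Complex.cot (π * z)).im := by linarith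
  rw [h4]
  have hzz : (π : ℂ) * z = ((π * x : ℝ) : ℂ) + ((π * a : ℝ) : ℂ) * Complex.I := by
    apply Complex.ext <;> simp [hz]
  have hsh : 0 < Real.sinh (π * a) := Real.sinh_pos_iff.2 (by positivity)
  rw [Complex.im_ofReal_mul, Complex.cot, hzz, Complex.sin_add_mul_I, Complex.cos_add_mul_I, Complex.div_im]
  simp only [← Complex.ofReal_sin, ← Complex.ofReal_cos, ← Complex.ofReal_sinh, ← Complex.ofReal_cosh]
  have q1 := Real.cosh_sq (π * a)
  have q2 := Real.sin_sq_add_cos_sq (π * x)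
  generalize Real.sinh (π * a) = sh at *
  generalize Real.cosh (π * a) = ch at *
  generalize Real.sin (π * x) = s at *
  generalize Real.cos (π * x) = c at *
  have e : Complex.normSq ((s : ℂ) * ch + c * sh * Complex.I) = sh ^ 2 + s ^ 2 := by
    rw [Complex.normSq_apply]
    simp
    linear_combination s ^ 2 * q1 + sh ^ 2 * q2
  rw [e]
  simp
  have : sh ^ 2 + s ^ 2 ≠ 0 := by positivity
  field_simp
  linear_combination ch * q2

theorem G_deriv (b : ℝ) (z : ℂ) (hz : z ≠ 0) (t : ℝ) :
    HasDerivAt (fun t : ℝ => -(1 / z + b * t / z + b / z ^ 2) * Complex.exp (-z * t))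
      ((1 + b * t) * Complex.exp (-z * t)) t := by
  have h1 : HasDerivAt (fun t : ℂ => -(1 / z + b * t / z + b / z ^ 2) * Complex.exp (-z * t))
      ((1 + b * t) * Complex.exp (-z * t)) (t : ℂ) := by
    have e1 : HasDerivAt (fun t : ℂ => -z * t) (-z) (t : ℂ) := by
      simpa using (hasDerivAt_id (t : ℂ)).const_mul (-z)
    have e2 : HasDerivAt (fun t : ℂ => -(1 / z + b * t / z + b / z ^ 2)) (-(b / z)) (t : ℂ) := by
      have := (((((hasDerivAt_id (t : ℂ)).const_mul (b : ℂ)).div_const z).const_add (1 / z)).add_const (b / z ^ 2)).neg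
      refine this.congr_deriv (by simp)
    refine (e2.mul e1.cexp).congr_deriv ?_
    field_simp
    ring
  exact h1.comp_ofReal

theorem exp_lin_tendsto (b : ℝ) (z : ℂ) (hz : 0 < z.re) :
    Filter.Tendsto (fun t : ℝ => -(1 / z + b * t / z + b / z ^ 2) * Complex.exp (-z * t))
      Filter.atTop (nhds 0) := by
  have h0 : Filter.Tendsto (fun t : ℝ => Complex.exp (-z * t)) Filter.atTop (nhds 0) := by
    rw [tendsto_zero_iff_norm_tendsto_zero]
    have := tendsto_rpow_mul_exp_neg_mul_atTop_nhds_zero 0 z.re hz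
    simpa [Complex.norm_exp] using this
  have h1 : Filter.Tendsto (fun t : ℝ => (t : ℂ) * Complex.exp (-z * t)) Filter.atTop (nhds 0) := by
    rw [tendsto_zero_iff_norm_tendsto_zero]
    have := (tendsto_rpow_mul_exp_neg_mul_atTop_nhds_zero 1 z.re hz).norm
    simpa [Complex.norm_exp] using this
  have := ((h0.const_mul (-(1 / z + b / z ^ 2))).add (h1.const_mul (-(b / z))))
  simp only [mul_zero, add_zero] at this
  refine this.congr (fun t => ?_)
  ring

theorem int_real (b : ℝ) (hb : 0 < b) :
    IntegrableOn (fun t : ℝ => (1 + b * t) * Real.exp (-b * t)) (Set.Ioi 0) := by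
  have h := exp_lin_tendsto b b (by simpa using hb)
  have h2 : Filter.Tendsto (fun t : ℝ => -(1 / b + b * t / b + b / b ^ 2) * Real.exp (-b * t)) Filter.atTop (nhds 0) := by
    have := (Complex.continuous_re.tendsto 0).comp h
    refine Filter.Tendsto.congr (fun t => ?_) this
    rw [Function.comp, ← Complex.ofReal_re (-(1 / b + b * t / b + b / b ^ 2) * Real.exp (-b * t))]
    push_cast; rfl
  refine integrableOn_Ioi_deriv_of_nonneg' (g := fun t : ℝ => -(1 / b + b * t / b + b / b ^ 2) * Real.exp (-b * t)) (l := 0) ?_ ?_ h2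
  · intro t _
    have := (G_deriv b b (by exact_mod_cast hb.ne') t)
    have h3 := Complex.reCLM.hasFDerivAt.comp_hasDerivAt t this
    have h4 : (Complex.reCLM ((1 + b * t) * Complex.exp (-b * t))) = (1 + b * t) * Real.exp (-b * t) := by
      rw [Complex.reCLM_apply, ← Complex.ofReal_re ((1 + b * t) * Real.exp (-b * t))]
      push_cast; rfl
    rw [h4] at h3
    refine h3.congr_of_eventuallyEq (Filter.Eventually.of_forall fun s => ?_)
    beta_reduce
    rw [Function.comp, Complex.reCLM_apply, ← Complex.ofReal_re (-(1 / b + b * s / b + b / b ^ 2) * Real.exp (-b * s))]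
    push_cast; rfl
  · intro t ht
    have : 0 < t := ht
    positivity

theorem int_half (b : ℝ) (hb : 0 < b) (z : ℂ) (hz : z.re = b) :
    IntegrableOn (fun t : ℝ => (1 + b * t) * Complex.exp (-z * t)) (Set.Ioi 0) ∧
    ∫ t : ℝ in Set.Ioi 0, (1 + b * t) * Complex.exp (-z * t) = 1 / z + b / z ^ 2 := by
  have hz0 : z ≠ 0 := by rintro rfl; simp at hz; exact hb.ne hz
  have hi : IntegrableOn (fun t : ℝ => (1 + b * t) * Complex.exp (-z * t)) (Set.Ioi 0) := by
    refine Integrable.mono (int_real b hb) (Continuous.aestronglyMeasurable (by fun_prop)) ?_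
    refine Filter.Eventually.of_forall (fun t => le_of_eq ?_)
    rw [norm_mul, norm_mul, Complex.norm_exp]
    congr 1
    · rw [← Complex.norm_real]; push_cast; rfl
    · simp [hz]
  refine ⟨hi, ?_⟩
  rw [integral_Ioi_of_hasDerivAt_of_tendsto' (fun t _ => G_deriv b z hz0 t) hi (exp_lin_tendsto b z (hz ▸ hb))]
  simp

noncomputable def gfun (b : ℝ) (t : ℝ) : ℂ := (1 + b * |t|) * Complex.exp (-b * |t|)

theorem g_fourier (b : ℝ) (hb : 0 < b) (q : ℝ) :
    Integrable (fun t : ℝ => Complex.exp (-(q * t) * Complex.I) * gfun b t) ∧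
    ∫ t : ℝ, Complex.exp (-(q * t) * Complex.I) * gfun b t = ((4 * b ^ 3 / (b ^ 2 + q ^ 2) ^ 2 : ℝ) : ℂ) := by
  set F : ℝ → ℂ := fun t : ℝ => Complex.exp (-(q * t) * Complex.I) * gfun b t with hF
  set z : ℂ := b + q * Complex.I with hz
  set z' : ℂ := b - q * Complex.I with hz'
  obtain ⟨i1, e1⟩ := int_half b hb z (by simp [hz])
  obtain ⟨i2, e2⟩ := int_half b hb z' (by simp [hz'])
  have c1 : ∀ t ∈ Set.Ioi (0 : ℝ), (1 + b * t) * Complex.exp (-z * t) = F t := by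
    intro t ht
    have ht : 0 < t := ht
    simp only [hF, gfun, abs_of_pos ht]
    rw [mul_left_comm, ← Complex.exp_add]
    congr 2
    simp only [hz]; ring
  have c2 : ∀ t ∈ Set.Ioi (0 : ℝ), (1 + b * t) * Complex.exp (-z' * t) = F (-t) := by
    intro t ht
    have ht : 0 < t := ht
    simp only [hF, gfun, abs_neg, abs_of_pos ht]
    rw [mul_left_comm, ← Complex.exp_add]
    congr 2
    simp only [hz']; push_cast; ring
  have j1 : IntegrableOn F (Set.Ioi 0) := i1.congr_fun c1 measurableSet_Ioi
  have j2 : IntegrableOn (fun t => F (-t)) (Set.Ioi 0) := i2.congr_fun c2 measurableSet_Ioi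
  have j3 : IntegrableOn F (Set.Iic 0) := by
    rw [integrableOn_Iic_iff_integrableOn_Iio]
    simpa using j2.comp_neg
  have j4 : Integrable F := by
    rw [← integrableOn_univ, ← Set.Iic_union_Ioi (a := (0 : ℝ))]
    exact j3.union j1
  refine ⟨j4, ?_⟩
  rw [← intervalIntegral.integral_Iic_add_Ioi j3 j1, ← setIntegral_congr_fun measurableSet_Ioi c1, e1]
  have k := integral_comp_neg_Ioi 0 F
  rw [neg_zero] at k
  rw [← k, ← setIntegral_congr_fun measurableSet_Ioi c2, e2]
  have hzz : z * z' = ((b ^ 2 + q ^ 2 : ℝ) : ℂ) := by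
    simp only [hz, hz']; push_cast
    linear_combination (-(q : ℂ) ^ 2) * Complex.I_sq
  have hN : ((b ^ 2 + q ^ 2 : ℝ) : ℂ) ≠ 0 := by
    have : b ^ 2 + q ^ 2 ≠ 0 := by positivity
    exact_mod_cast this
  have hz0 : z ≠ 0 := by rintro h; rw [h, zero_mul] at hzz; exact hN hzz.symm
  have hz0' : z' ≠ 0 := by rintro h; rw [h, mul_zero] at hzz; exact hN hzz.symm
  have hs : z + z' = 2 * b := by simp only [hz, hz']; ring
  rw [Complex.ofReal_div, Complex.ofReal_pow, ← hzz]
  field_simp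
  push_cast
  push_cast at hzz
  have : (b : ℂ) * 4 * b ^ 2 = b * (z + z') ^ 2 := by rw [hs]; ring
  have hb' : (b : ℂ) = (z + z') / 2 := by rw [hs]; ring
  rw [hb']; ring

theorem g_cont (b : ℝ) : Continuous (gfun b) := by
  unfold gfun; fun_prop

open FourierTransform in
theorem cos_int (θ h : ℝ) (hθ : 0 < θ) (hh : 0 ≤ h)
    (hint : Integrable (fun w : ℝ => (θ / (θ ^ 2 + w ^ 2)) ^ 2)) :
    ∫ w : ℝ, (θ / (θ ^ 2 + w ^ 2)) ^ 2 * Real.cos (2 * π * h * w) =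
      π / (2 * θ) * (1 + 2 * π * h * θ) * Real.exp (-(2 * π * h * θ)) := by
  set b := 2 * π * θ with hb
  have hb0 : 0 < b := by positivity
  have hF : 𝓕 (gfun b) = fun w : ℝ => ((2 * θ / π * (θ / (θ ^ 2 + w ^ 2)) ^ 2 : ℝ) : ℂ) := by
    funext w
    rw [Real.fourier_real_eq_integral_exp_smul]
    have := (g_fourier b hb0 (2 * π * w)).2
    simp only [smul_eq_mul]
    convert this using 1
    · congr 1; funext t; congr 2; push_cast; ring
    · congr 1
      have : θ ^ 2 + w ^ 2 ≠ 0 := by positivity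
      have e : b ^ 2 + (2 * π * w) ^ 2 = 4 * π ^ 2 * (θ ^ 2 + w ^ 2) := by rw [hb]; ring
      rw [e, hb]
      field_simp
      ring
  have hi : Integrable (gfun b) := by simpa using (g_fourier b hb0 0).1
  have hi2 : Integrable (𝓕 (gfun b)) := by
    rw [hF]; exact (hint.const_mul _).ofReal
  have inv := congrFun ((g_cont b).fourierInv_fourier_eq hi hi2) h
  rw [Real.fourierInv_eq', hF] at inv
  have hre := congrArg Complex.re inv
  rw [← Complex.reCLM_apply, ← ContinuousLinearMap.integral_comp_comm] at hre
  swap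
  · refine Integrable.mono (hint.const_mul (2 * θ / π)) ?_ ?_
    · refine Continuous.aestronglyMeasurable ?_
      have : ∀ w : ℝ, θ ^ 2 + w ^ 2 ≠ 0 := fun w => by positivity
      simp only [smul_eq_mul]
      refine Continuous.mul (by fun_prop) (Complex.continuous_ofReal.comp ?_)
      fun_prop (disch := exact this _)
    · refine Filter.Eventually.of_forall (fun w => le_of_eq ?_)
      rw [norm_smul, Complex.norm_exp_ofReal_mul_I, one_mul, Complex.norm_real]
  have hl : ∀ w : ℝ, Complex.reCLM (Complex.exp (((2 * π * inner ℝ w h : ℝ) : ℂ) * Complex.I) •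
      ((2 * θ / π * (θ / (θ ^ 2 + w ^ 2)) ^ 2 : ℝ) : ℂ)) =
      2 * θ / π * ((θ / (θ ^ 2 + w ^ 2)) ^ 2 * Real.cos (2 * π * h * w)) := by
    intro w
    rw [Complex.reCLM_apply, smul_eq_mul, Complex.re_mul_ofReal, Complex.exp_ofReal_mul_I_re]
    have : 2 * π * inner ℝ w h = 2 * π * h * w := by
      have hin : inner ℝ w h = h * w := by
        simp [mul_comm]
      rw [hin]; ring
    rw [this]; ring
  simp only [hl] at hre
  rw [integral_const_mul] at hre
  have hr : (gfun b h).re = (1 + 2 * π * h * θ) * Real.exp (-(2 * π * h * θ)) := by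
    rw [gfun, abs_of_nonneg hh, ← Complex.ofReal_re ((1 + 2 * π * h * θ) * Real.exp (-(2 * π * h * θ)))]
    rw [hb]; push_cast
    congr 2
    · ring
    · congr 1; ring
  rw [hr] at hre
  generalize (∫ w : ℝ, (θ / (θ ^ 2 + w ^ 2)) ^ 2 * Real.cos (2 * π * h * w)) = J at *
  have hp := Real.pi_pos
  rw [mul_assoc, ← hre]
  field_simp

theorem F_int (θ : ℝ) (hθ : 0 < θ) : Integrable (fun w : ℝ => θ / (θ ^ 2 + w ^ 2)) ∧
    ∫ w : ℝ, θ / (θ ^ 2 + w ^ 2) = π := by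
  have e : (fun w : ℝ => θ / (θ ^ 2 + w ^ 2)) = fun w : ℝ => θ⁻¹ * (1 + (w / θ) ^ 2)⁻¹ := by
    funext w
    have : θ ^ 2 + w ^ 2 ≠ 0 := by positivity
    have : 1 + (w / θ) ^ 2 ≠ 0 := by positivity
    field_simp
  rw [e]
  refine ⟨(integrable_inv_one_add_sq.comp_div hθ.ne').const_mul _, ?_⟩
  rw [integral_const_mul, Measure.integral_comp_div (fun x : ℝ => (1 + x ^ 2)⁻¹), integral_univ_inv_one_add_sq, abs_of_pos hθ,
    smul_eq_mul]
  field_simp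

theorem F2_int (θ : ℝ) (hθ : 0 < θ) : Integrable (fun w : ℝ => (θ / (θ ^ 2 + w ^ 2)) ^ 2) := by
  have hne : ∀ w : ℝ, θ ^ 2 + w ^ 2 ≠ 0 := fun w => by positivity
  refine Integrable.mono' ((F_int θ hθ).1.const_mul θ⁻¹) (Continuous.aestronglyMeasurable ?_) ?_
  · fun_prop (disch := exact hne _)
  · refine Filter.Eventually.of_forall (fun w => ?_)
    rw [Real.norm_of_nonneg (by positivity), sq]
    refine mul_le_mul_of_nonneg_right ?_ (by positivity)
    rw [div_le_iff₀ (by positivity)]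
    have : θ⁻¹ * (θ ^ 2 + w ^ 2) = θ + θ⁻¹ * w ^ 2 := by field_simp
    rw [this]
    have : 0 ≤ θ⁻¹ * w ^ 2 := by positivity
    linarith

theorem S_closed (θ h ω : ℝ) (hθ : 0 < θ) (hh : 0 < h) :
    (∑' k : ℤ, θ / (θ ^ 2 + (ω + (k : ℝ) / h) ^ 2))⁻¹ =
      1 / (π * h * coth (π * θ * h)) *
        (1 + Real.sin (π * h * ω) ^ 2 * (coth (π * θ * h) ^ 2 - 1)) := by
  have e : ∀ k : ℤ, θ / (θ ^ 2 + (ω + (k : ℝ) / h) ^ 2) =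
      h * ((θ * h) / ((θ * h) ^ 2 + (ω * h + (k : ℝ)) ^ 2)) := by
    intro k
    have h1 : θ ^ 2 + (ω + (k : ℝ) / h) ^ 2 ≠ 0 := by positivity
    have h2 : (θ * h) ^ 2 + (ω * h + (k : ℝ)) ^ 2 ≠ 0 := by positivity
    rw [← mul_div_assoc, div_eq_div_iff h1 h2]
    field_simp
  simp only [e]
  rw [tsum_mul_left, S_closed_aux (ω * h) (θ * h) (by positivity), coth]
  rw [show π * (θ * h) = π * θ * h by ring, show π * (ω * h) = π * h * ω by ring]
  have hp := Real.pi_pos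
  have hsh : 0 < Real.sinh (π * θ * h) := Real.sinh_pos_iff.2 (by positivity)
  have hch := Real.cosh_pos (π * θ * h)
  have q1 := Real.cosh_sq (π * θ * h)
  generalize Real.sinh (π * θ * h) = sh at *
  generalize Real.cosh (π * θ * h) = ch at *
  generalize Real.sin (π * h * ω) = s at *
  have : sh ^ 2 + s ^ 2 ≠ 0 := by positivity
  field_simp
  rw [q1]; ring

/-- Closed form of the correctly specified interpolation error for the exponential
(Matérn `ν = 1/2`) spectral density: for `θ > 0`, `h > 0`, with `c = coth(π θ h)`,
`∫ (θ/(θ² + ω²))·(1 − F_θ(ω)/S_{θ,h}(ω)) dω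
  = π − (1/(πhc))·[π/(2θ) + (c² − 1)·(π/(4θ))·(1 − e^{−2πhθ}(1 + 2πhθ))]`,
where `F_θ(ω) = θ/(θ² + ω²)` and `S_{θ,h}(ω) = ∑_{k ∈ ℤ} F_θ(ω + k/h)`. -/
theorem interpolation_error_closed_form (θ h : ℝ) (hθ : 0 < θ) (hh : 0 < h) :
    ∫ ω : ℝ, θ / (θ ^ 2 + ω ^ 2) *
        (1 - (θ / (θ ^ 2 + ω ^ 2)) / ∑' k : ℤ, θ / (θ ^ 2 + (ω + (k : ℝ) / h) ^ 2)) =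
      π - 1 / (π * h * coth (π * θ * h)) *
        (π / (2 * θ) + (coth (π * θ * h) ^ 2 - 1) * (π / (4 * θ)) *
          (1 - Real.exp (-(2 * π * h * θ)) * (1 + 2 * π * h * θ))) := by
  have hS : ∀ ω : ℝ, θ / (θ ^ 2 + ω ^ 2) *
        (1 - (θ / (θ ^ 2 + ω ^ 2)) / ∑' k : ℤ, θ / (θ ^ 2 + (ω + (k : ℝ) / h) ^ 2)) =
      θ / (θ ^ 2 + ω ^ 2) - 1 / (π * h * coth (π * θ * h)) *
        ((1 + (coth (π * θ * h) ^ 2 - 1) / 2) * (θ / (θ ^ 2 + ω ^ 2)) ^ 2 -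
          (coth (π * θ * h) ^ 2 - 1) / 2 *
            ((θ / (θ ^ 2 + ω ^ 2)) ^ 2 * Real.cos (2 * π * h * ω))) := by
    intro ω
    rw [div_eq_mul_inv _ (∑' k : ℤ, _), S_closed θ h ω hθ hh]
    have hc : Real.cos (2 * π * h * ω) = 1 - 2 * Real.sin (π * h * ω) ^ 2 := by
      rw [show 2 * π * h * ω = 2 * (π * h * ω) by ring, Real.cos_two_mul, Real.cos_sq']
      ring
    rw [hc]; ring
  simp only [hS]
  obtain ⟨iF, eF⟩ := F_int θ hθ
  have iF2 := F2_int θ hθ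
  have eC := cos_int θ h hθ hh.le iF2
  have e2 := cos_int θ 0 hθ le_rfl iF2
  simp only [mul_zero, zero_mul, Real.cos_zero, mul_one, add_zero, neg_zero, Real.exp_zero] at e2
  have iC : Integrable (fun ω : ℝ => (θ / (θ ^ 2 + ω ^ 2)) ^ 2 * Real.cos (2 * π * h * ω)) := by
    refine Integrable.mono iF2 (iF2.aestronglyMeasurable.mul
      (Continuous.aestronglyMeasurable (by fun_prop))) (Filter.Eventually.of_forall fun ω => ?_)
    rw [norm_mul]
    exact mul_le_of_le_one_right (norm_nonneg _) (Real.abs_cos_le_one _)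
  have iD : Integrable (fun ω : ℝ => (1 + (coth (π * θ * h) ^ 2 - 1) / 2) * (θ / (θ ^ 2 + ω ^ 2)) ^ 2 -
      (coth (π * θ * h) ^ 2 - 1) / 2 *
        ((θ / (θ ^ 2 + ω ^ 2)) ^ 2 * Real.cos (2 * π * h * ω))) :=
    (iF2.const_mul _).sub (iC.const_mul _)
  rw [integral_sub iF (iD.const_mul _), integral_const_mul,
    integral_sub (iF2.const_mul _) (iC.const_mul _), integral_const_mul, integral_const_mul,
    eF, eC, e2]
  ring
end

section
/- Fix θ > 0 and define σ_h²(θ) = ∫_ℝ F_θ(ω) · (1 − F_θ(ω)/S_{θ,h}(ω)) dω, where F_θ(ω) = θ/(θ² + ω²) and S_{θ,h}(ω) = ∑_{k ∈ ℤ} F_θ(ω + k/h). Then lim_{h → 0⁺} σ_h²(θ)/h = (2/3) π² θ; equivalently, σ_h²(θ) = (2/3) π² θ h + O((θh)²) as θh → 0. -/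
open Real MeasureTheory Filter Topology

lemma aux_lim : Tendsto (fun a : ℝ => (a * cosh a - sinh a) / (a ^ 2 * sinh a)) (𝓝[>] 0) (𝓝 (1/3)) := by
  have h1 : Tendsto (fun a : ℝ => sinh a / a) (𝓝[>] 0) (𝓝 1) := by
    have := (Real.hasDerivAt_sinh 0)
    rw [hasDerivAt_iff_tendsto_slope_zero] at this
    simp only [zero_add, sinh_zero, sub_zero, cosh_zero, smul_eq_mul] at this
    refine (this.mono_left (nhdsWithin_mono _ (fun x hx => ne_of_gt hx))).congr (fun x => ?_)
    field_simp
  have h2 : Tendsto (fun a : ℝ => (a * cosh a - sinh a) / a ^ 3) (𝓝[>] 0) (𝓝 (1/3)) := by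
    apply HasDerivAt.lhopital_zero_nhdsGT (f' := fun a => a * sinh a) (g' := fun a => 3 * a ^ 2)
    · refine Eventually.of_forall fun x => ?_
      have := ((hasDerivAt_id x).mul (Real.hasDerivAt_cosh x)).sub (Real.hasDerivAt_sinh x)
      convert! this using 1
      simp
    · refine Eventually.of_forall fun x => ?_
      simpa using hasDerivAt_pow 3 x
    · filter_upwards [self_mem_nhdsWithin] with x hx
      have : x ≠ 0 := ne_of_gt hx
      positivity
    · refine tendsto_nhdsWithin_of_tendsto_nhds ?_
      have : Continuous fun a : ℝ => a * cosh a - sinh a := by fun_prop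
      simpa using this.tendsto 0
    · refine tendsto_nhdsWithin_of_tendsto_nhds ?_
      have : Continuous fun a : ℝ => a ^ 3 := by fun_prop
      simpa using this.tendsto 0
    · have := h1.div_const 3
      refine this.congr' ?_
      filter_upwards [self_mem_nhdsWithin] with x hx
      have : x ≠ 0 := ne_of_gt hx
      field_simp
  have := h2.div h1 one_ne_zero
  rw [div_one] at this
  refine this.congr' ?_
  filter_upwards [self_mem_nhdsWithin] with x hx
  have : x ≠ 0 := ne_of_gt hx
  have : sinh x ≠ 0 := (Real.sinh_pos_iff.2 hx).ne'
  simp only [Pi.div_apply]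
  field_simp

lemma aux_int_exp (θ : ℝ) (c : ℂ) (hc : 0 < c.re) :
    IntegrableOn (fun x : ℝ => (1 + θ * x : ℂ) * Complex.exp (-c * x)) (Set.Ioi 0) ∧
    ∫ x in Set.Ioi (0:ℝ), (1 + θ * x : ℂ) * Complex.exp (-c * x) = 1 / c + θ / c ^ 2 := by
  have hc0 : c ≠ 0 := by rintro rfl; simp at hc
  have i1 : IntegrableOn (fun x : ℝ => Complex.exp (-c * x)) (Set.Ioi 0) :=
    integrableOn_exp_mul_complex_Ioi (by simpa using hc) 0
  have i2 : IntegrableOn (fun x : ℝ => (x : ℂ) * Complex.exp (-c * x)) (Set.Ioi 0) := by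
    have := integrableOn_rpow_mul_exp_neg_mul_rpow (s := 1) (p := 1) (b := c.re) (by norm_num) (by norm_num) hc
    refine Integrable.mono' this (by fun_prop) ?_
    refine (ae_restrict_iff' measurableSet_Ioi).2 (Eventually.of_forall fun x hx => ?_)
    have hx : 0 < x := hx
    simp [Complex.norm_exp, abs_of_pos hx]
  have i3 : IntegrableOn (fun x : ℝ => (1 + θ * x : ℂ) * Complex.exp (-c * x)) (Set.Ioi 0) := by
    have := i1.add (i2.const_mul (θ : ℂ))
    refine this.congr (Eventually.of_forall fun x => ?_)
    simp; ring
  refine ⟨i3, ?_⟩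
  have e0 : Tendsto (fun x : ℝ => Complex.exp (-c * x)) atTop (𝓝 0) := by
    rw [tendsto_zero_iff_norm_tendsto_zero]
    have := tendsto_rpow_mul_exp_neg_mul_atTop_nhds_zero 0 c.re hc
    simpa [Complex.norm_exp] using this
  have e1 : Tendsto (fun x : ℝ => (x:ℂ) * Complex.exp (-c * x)) atTop (𝓝 0) := by
    rw [tendsto_zero_iff_norm_tendsto_zero]
    have := tendsto_rpow_mul_exp_neg_mul_atTop_nhds_zero 1 c.re hc
    refine this.congr' ?_
    filter_upwards [eventually_gt_atTop 0] with x hx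
    simp [Complex.norm_exp, abs_of_pos hx]
  have key := integral_Ioi_of_hasDerivAt_of_tendsto' (a := (0:ℝ))
    (f := fun x : ℝ => -(1 / c + θ / c ^ 2) * Complex.exp (-c * x) - θ / c * ((x:ℂ) * Complex.exp (-c * x)))
    (f' := fun x : ℝ => (1 + θ * x : ℂ) * Complex.exp (-c * x)) (m := 0) ?_ i3 ?_
  · rw [key]; simp
  · intro x _
    have hE : HasDerivAt (fun x : ℝ => Complex.exp (-c * x)) (Complex.exp (-c * x) * (-c * 1)) x :=
      (((hasDerivAt_id (x:ℂ)).const_mul (-c)).cexp).comp_ofReal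
    have hX : HasDerivAt (fun x : ℝ => (x:ℂ)) 1 x := (hasDerivAt_id (x:ℂ)).comp_ofReal
    have := (hE.const_mul (-(1 / c + θ / c ^ 2))).sub ((hX.mul hE).const_mul (θ / c : ℂ))
    convert! this using 1
    field_simp
    ring
  · have := (e0.const_mul (-(1 / c + θ / c ^ 2))).sub (e1.const_mul (θ / c : ℂ))
    rwa [mul_zero, mul_zero, sub_zero] at this

lemma aux_cauchy_int (θ : ℝ) (hθ : 0 < θ) : Integrable (fun ω : ℝ => θ / (θ ^ 2 + ω ^ 2)) ∧
    ∫ ω : ℝ, θ / (θ ^ 2 + ω ^ 2) = π := by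
  have e : (fun ω : ℝ => θ / (θ ^ 2 + ω ^ 2)) = fun ω => θ⁻¹ * (1 + (θ⁻¹ * ω) ^ 2)⁻¹ := by
    ext ω; field_simp
  rw [e]
  constructor
  · exact (integrable_inv_one_add_sq.comp_mul_left' (inv_ne_zero hθ.ne')).const_mul _
  · rw [integral_const_mul, Measure.integral_comp_mul_left (fun x => (1 + x ^ 2)⁻¹),
      integral_univ_inv_one_add_sq]
    simp [abs_of_pos hθ]
    field_simp

lemma aux_cot (x y : ℝ) (hy : 0 < y) :
    (Complex.cot (π * (x + y * Complex.I))).im =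
      - sinh (2 * π * y) / (cosh (2 * π * y) - cos (2 * π * x)) := by
  have e : (π * (x + y * Complex.I) : ℂ) = ((π * x : ℝ) : ℂ) + ((π * y : ℝ) : ℂ) * Complex.I := by
    push_cast; ring
  have hs : 0 < sinh (π * y) := Real.sinh_pos_iff.2 (by positivity)
  rw [Complex.cot, e, Complex.cos_add_mul_I, Complex.sin_add_mul_I]
  rw [show 2 * π * y = 2 * (π * y) by ring, show 2 * π * x = 2 * (π * x) by ring]
  generalize π * x = u at *
  generalize π * y = v at *
  simp only [← Complex.ofReal_cos, ← Complex.ofReal_sin, ← Complex.ofReal_cosh, ← Complex.ofReal_sinh]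
  rw [Complex.div_im]
  simp only [Complex.normSq_apply, Complex.add_re, Complex.sub_re, Complex.mul_re, Complex.add_im,
    Complex.sub_im, Complex.mul_im, Complex.ofReal_re, Complex.ofReal_im, Complex.I_re,
    Complex.I_im, mul_zero, zero_mul, mul_one, sub_zero, add_zero, zero_add, zero_sub]
  rw [Real.sinh_two_mul, Real.cosh_two_mul, Real.cos_two_mul]
  have h1 := Real.cosh_sq v
  have h2 := Real.sin_sq_add_cos_sq u
  have hd : sin u * cosh v * (sin u * cosh v) + cos u * sinh v * (cos u * sinh v) =
     sin u ^ 2 + sinh v ^ 2 := by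
    linear_combination (sin u ^ 2) * h1 + sinh v ^2 * h2
  have hd2 : cosh v ^ 2 + sinh v ^ 2 - (2 * cos u ^ 2 - 1) = 2 * (sin u ^ 2 + sinh v ^ 2) := by
    linear_combination h1 - 2 * h2
  have : 0 < sin u ^ 2 + sinh v ^ 2 := by positivity
  rw [hd, hd2]
  field_simp
  linear_combination - h2

lemma aux_S (θ h ω : ℝ) (hθ : 0 < θ) (hh : 0 < h) :
    ∑' k : ℤ, θ / (θ ^ 2 + (ω + (k : ℝ) / h) ^ 2) =
      π * h * sinh (2 * π * (θ * h)) / (cosh (2 * π * (θ * h)) - cos (2 * π * (ω * h))) := by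
  set y := θ * h with hy
  set x := ω * h with hx
  have hy0 : 0 < y := by positivity
  set z : ℂ := x + y * Complex.I with hz
  have hzim : z.im = y := by simp [hz]
  have hzm : z ∈ Complex.integerComplement := by
    rintro ⟨k, hk⟩
    have := congrArg Complex.im hk
    rw [hzim] at this; simp at this; linarith
  have hs : HasSum (fun n : ℕ => 1 / (z - (n + 1)) + 1 / (z + (n + 1)))
      (π * Complex.cot (π * z) - 1 / z) := by
    rw [cot_series_rep' hzm]
    exact (summable_cotTerm hzm).hasSum
  have him : ∀ t : ℝ, (1 / (z + t)).im = - (y / (y ^ 2 + (x + t) ^ 2)) := by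
    intro t
    rw [one_div, Complex.inv_im, Complex.normSq_apply]
    simp [hz]; ring
  have him' : ∀ t : ℝ, (1 / (z - t)).im = - (y / (y ^ 2 + (x - t) ^ 2)) := by
    intro t
    have := him (-t)
    simpa [sub_eq_add_neg] using this
  have hs2 := (Complex.hasSum_im hs).neg
  have hG : ∀ k : ℤ, θ / (θ ^ 2 + (ω + (k : ℝ) / h) ^ 2) = h * (y / (y ^ 2 + (x + k) ^ 2)) := by
    intro k
    rw [hx, hy]; field_simp
  simp_rw [hG]
  rw [tsum_mul_left]
  set f : ℤ → ℝ := fun k => y / (y ^ 2 + (x + k) ^ 2) with hf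
  have hs3 : HasSum (fun n : ℕ => f (n + 1) + f (-(n + 1)))
     (π * (sinh (2 * π * y) / (cosh (2 * π * y) - cos (2 * π * x))) - f 0) := by
    convert! hs2 using 1
    · ext n
      have a := him (n + 1)
      have b := him' (n + 1)
      push_cast at a b
      rw [Complex.add_im, a, b]
      simp [hf, sub_eq_add_neg]
    · have a := him 0
      simp only [Complex.ofReal_zero, add_zero] at a
      rw [Complex.sub_im, a, Complex.im_ofReal_mul, aux_cot x y hy0]
      simp [hf]; ring
  have hp : Summable fun n : ℕ => f (n + 1) := by
    refine Summable.of_nonneg_of_le (fun n => ?_) (fun n => ?_) hs3.summable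
    · simp only [hf]; positivity
    · have : 0 ≤ f (-(n + 1)) := by simp only [hf]; positivity
      linarith
  have hn : Summable fun n : ℕ => f (-(n + 1)) := by
    refine Summable.of_nonneg_of_le (fun n => ?_) (fun n => ?_) hs3.summable
    · simp only [hf]; positivity
    · have : 0 ≤ f (n + 1) := by simp only [hf]; positivity
      linarith
  have := (HasSum.of_add_one_of_neg_add_one hp.hasSum hn.hasSum).tsum_eq
  have h4 := (hp.hasSum.add hn.hasSum).unique hs3
  rw [this, add_right_comm, h4]
  ring

lemma aux_sq_int (θ : ℝ) (hθ : 0 < θ) : Integrable (fun ω : ℝ => 1 / (θ ^ 2 + ω ^ 2) ^ 2) := by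
  refine Integrable.mono' ((aux_cauchy_int θ hθ).1.const_mul (1 / θ ^ 3)) ?_ ?_
  · refine Continuous.aestronglyMeasurable ?_
    refine Continuous.div (by fun_prop) (by fun_prop) (fun x => by positivity)
  · refine Eventually.of_forall fun x => ?_
    rw [Real.norm_of_nonneg (by positivity)]
    rw [show 1 / θ ^ 3 * (θ / (θ ^ 2 + x ^ 2)) = 1 / (θ ^ 2 * (θ ^ 2 + x ^ 2)) by field_simp]
    refine one_div_le_one_div_of_le (by positivity) ?_
    rw [sq (θ ^ 2 + x ^ 2)]
    have := sq_nonneg x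
    gcongr
    linarith

lemma aux_cos_int (θ t : ℝ) (hθ : 0 < θ) :
    Integrable (fun ω : ℝ => cos (t * ω) * (1 / (θ ^ 2 + ω ^ 2) ^ 2)) := by
  refine Integrable.bdd_mul (c := 1) (aux_sq_int θ hθ) (by fun_prop) ?_
  exact Eventually.of_forall fun x => by simpa using Real.abs_cos_le_one _

open FourierTransform in
lemma aux_fourier (θ : ℝ) (hθ : 0 < θ) (t : ℝ) (ht : 0 ≤ t) :
    ∫ ω : ℝ, cos (t * ω) * (1 / (θ ^ 2 + ω ^ 2) ^ 2) =
      π / (2 * θ ^ 3) * ((1 + θ * t) * exp (- θ * t)) := by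
  set g : ℝ → ℂ := fun x => (1 + θ * |x| : ℂ) * Complex.exp (- θ * |x|) with hg
  have hgc : Continuous g := by
    have : Continuous fun x : ℝ => ((|x| : ℝ) : ℂ) := Complex.continuous_ofReal.comp continuous_abs
    simp only [hg]; fun_prop
  -- half-line pieces
  have pos : ∀ w : ℝ, IntegrableOn (fun x : ℝ => Complex.exp (-2 * π * x * w * Complex.I) * g x) (Set.Ioi 0) ∧
      ∫ x in Set.Ioi (0:ℝ), Complex.exp (-2 * π * x * w * Complex.I) * g x =
        1 / (θ + 2 * π * w * Complex.I) + θ / (θ + 2 * π * w * Complex.I) ^ 2 := by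
    intro w
    have := aux_int_exp θ (θ + 2 * π * w * Complex.I) (by simpa using hθ)
    have e : Set.EqOn (fun x : ℝ => (1 + θ * x : ℂ) * Complex.exp (-(θ + 2 * π * w * Complex.I) * x))
      (fun x : ℝ => Complex.exp (-2 * π * x * w * Complex.I) * g x) (Set.Ioi 0) := by
      intro x hx
      have hx : 0 < x := hx
      simp only [hg, abs_of_pos hx]
      rw [mul_left_comm, ← Complex.exp_add]
      congr 2; ring
    rw [setIntegral_congr_fun measurableSet_Ioi e] at this
    exact ⟨this.1.congr_fun e measurableSet_Ioi, this.2⟩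
  have hneg : ∀ w x : ℝ, Complex.exp (-2 * π * (-x : ℝ) * w * Complex.I) * g (-x) =
      Complex.exp (-2 * π * x * (-w : ℝ) * Complex.I) * g x := by
    intro w x
    simp [hg]
  have negi : ∀ w : ℝ, IntegrableOn (fun x : ℝ => Complex.exp (-2 * π * x * w * Complex.I) * g x) (Set.Iic 0) := by
    intro w
    rw [integrableOn_Iic_iff_integrableOn_Iio]
    have := (pos (-w)).1
    have h2 := this.comp_neg
    simp only [← hneg, neg_neg] at h2
    simpa using h2
  have neg : ∀ w : ℝ, ∫ x in Set.Iic (0:ℝ), Complex.exp (-2 * π * x * w * Complex.I) * g x =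
        1 / (θ - 2 * π * w * Complex.I) + θ / (θ - 2 * π * w * Complex.I) ^ 2 := by
    intro w
    have h1 := integral_comp_neg_Ioi 0 (fun x : ℝ => Complex.exp (-2 * π * x * w * Complex.I) * g x)
    rw [neg_zero] at h1
    rw [← h1]
    simp_rw [hneg]
    rw [(pos (-w)).2]
    push_cast
    simp only [mul_neg, neg_mul, sub_eq_add_neg]
  have full : ∀ w : ℝ, Integrable (fun x : ℝ => Complex.exp (-2 * π * x * w * Complex.I) * g x) := by
    intro w
    rw [← integrableOn_univ, ← Set.Iic_union_Ioi (a := (0:ℝ))]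
    exact (negi w).union (pos w).1
  have hgi : Integrable g := by simpa using full 0
  have hF : 𝓕 g = fun w : ℝ => ((4 * θ ^ 3 * (1 / (θ ^ 2 + (2 * π * w) ^ 2) ^ 2) : ℝ) : ℂ) := by
    ext w
    rw [Real.fourier_real_eq_integral_exp_smul]
    have : ∀ x : ℝ, Complex.exp (((-2 * π * x * w : ℝ) : ℂ) * Complex.I) • g x = Complex.exp (-2 * π * x * w * Complex.I) * g x := by
      intro x; push_cast; rfl
    simp_rw [this]
    rw [← intervalIntegral.integral_Iic_add_Ioi (negi w) (pos w).1, neg, (pos w).2]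
    have hp : (θ + 2 * π * w * Complex.I : ℂ) ≠ 0 := by
      intro h; have := congrArg Complex.re h; simp at this; exact hθ.ne' this
    have hm : (θ - 2 * π * w * Complex.I : ℂ) ≠ 0 := by
      intro h; have := congrArg Complex.re h; simp at this; exact hθ.ne' this
    have hd : (θ ^ 2 + (2 * π * w) ^ 2 : ℂ) = (θ + 2 * π * w * Complex.I) * (θ - 2 * π * w * Complex.I) := by
      ring_nf; simp
    push_cast
    rw [hd]
    field_simp
    ring_nf
  have hFi : Integrable (𝓕 g) := by
    rw [hF]
    refine Integrable.ofReal ?_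
    exact ((aux_sq_int θ hθ).comp_mul_left' (R := 2 * π) (by positivity)).const_mul _
  have inv := congrFun (hgc.fourierInv_fourier_eq hgi hFi) t
  rw [Real.fourierInv_eq', hF] at inv
  have inv2 := congrArg Complex.re inv
  have hint : Integrable (fun v : ℝ => Complex.exp (((2 * π * inner ℝ v t : ℝ) : ℂ) * Complex.I) •
      ((4 * θ ^ 3 * (1 / (θ ^ 2 + (2 * π * v) ^ 2) ^ 2) : ℝ) : ℂ)) := by
    simp only [smul_eq_mul]
    refine Integrable.bdd_mul (c := 1) ?_ (by fun_prop) ?_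
    · rw [← hF]; exact hFi
    · exact Eventually.of_forall fun x => by rw [Complex.norm_exp_ofReal_mul_I]
  rw [← RCLike.re_eq_complex_re, ← integral_re hint] at inv2
  have e : ∀ v : ℝ, RCLike.re (Complex.exp (((2 * π * inner ℝ v t : ℝ) : ℂ) * Complex.I) •
      ((4 * θ ^ 3 * (1 / (θ ^ 2 + (2 * π * v) ^ 2) ^ 2) : ℝ) : ℂ)) =
      4 * θ ^ 3 * (fun ω => cos (t * ω) * (1 / (θ ^ 2 + ω ^ 2) ^ 2)) (2 * π * v) := by
    intro v
    rw [smul_eq_mul, RCLike.re_eq_complex_re, Complex.re_mul_ofReal, Complex.exp_ofReal_mul_I_re]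
    have : inner ℝ v t = t * v := by simp
    rw [this, show 2 * π * (t * v) = t * (2 * π * v) by ring]
    ring
  simp_rw [e] at inv2
  rw [integral_const_mul, Measure.integral_comp_mul_left
    (fun ω => cos (t * ω) * (1 / (θ ^ 2 + ω ^ 2) ^ 2))] at inv2
  have hgt : RCLike.re (g t) = (1 + θ * t) * exp (-θ * t) := by
    have : g t = (((1 + θ * t) * exp (-θ * t) : ℝ) : ℂ) := by
      simp only [hg, abs_of_nonneg ht]; push_cast; rfl
    rw [this, RCLike.re_eq_complex_re, Complex.ofReal_re]
  rw [hgt] at inv2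
  rw [← inv2, abs_of_pos (by positivity), smul_eq_mul]
  field_simp
  norm_num

lemma aux_sigma (θ h : ℝ) (hθ : 0 < θ) (hh : 0 < h) :
    (∫ ω : ℝ, θ / (θ ^ 2 + ω ^ 2) *
          (1 - (θ / (θ ^ 2 + ω ^ 2)) / ∑' k : ℤ, θ / (θ ^ 2 + (ω + (k : ℝ) / h) ^ 2))) =
    π * ((2 * π * θ * h) * cosh (2 * π * θ * h) - sinh (2 * π * θ * h)) /
      ((2 * π * θ * h) * sinh (2 * π * θ * h)) := by
  have hsinh : 0 < sinh (2 * π * θ * h) := Real.sinh_pos_iff.2 (by positivity)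
  have e : ∀ ω : ℝ, θ / (θ ^ 2 + ω ^ 2) *
          (1 - (θ / (θ ^ 2 + ω ^ 2)) / ∑' k : ℤ, θ / (θ ^ 2 + (ω + (k : ℝ) / h) ^ 2)) =
      θ / (θ ^ 2 + ω ^ 2) - (θ ^ 2 / (π * h * sinh (2 * π * θ * h)) * cosh (2 * π * θ * h) * (cos (0 * ω) * (1 / (θ ^ 2 + ω ^ 2) ^ 2))
       - θ ^ 2 / (π * h * sinh (2 * π * θ * h)) * (cos ((2 * π * h) * ω) * (1 / (θ ^ 2 + ω ^ 2) ^ 2))) := by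
    intro ω
    rw [aux_S θ h ω hθ hh, show 2 * π * (θ * h) = 2 * π * θ * h by ring,
      show 2 * π * (ω * h) = 2 * π * h * ω by ring, zero_mul, cos_zero]
    rw [div_div_eq_mul_div]
    field_simp
  simp_rw [e]
  have i0 := (aux_cos_int θ 0 hθ).const_mul (θ ^ 2 / (π * h * sinh (2 * π * θ * h)) * cosh (2 * π * θ * h))
  have i1 := (aux_cos_int θ (2 * π * h) hθ).const_mul (θ ^ 2 / (π * h * sinh (2 * π * θ * h)))
  rw [integral_sub (aux_cauchy_int θ hθ).1 (by simpa only [Pi.sub_def] using i0.sub i1), integral_sub i0 i1, integral_const_mul, integral_const_mul,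
    aux_fourier θ hθ 0 le_rfl, aux_fourier θ hθ (2 * π * h) (by positivity), (aux_cauchy_int θ hθ).2]
  rw [show θ * (2 * π * h) = 2 * π * θ * h by ring, show -θ * (2 * π * h) = -(2 * π * θ * h) by ring,
    ← Real.cosh_sub_sinh]
  simp only [mul_zero, exp_zero, add_zero, mul_one]
  field_simp
  ring

/-- Paper's Corollary 1: for the exponential (Matérn `ν = 1/2`) spectral density
`F_θ(ω) = θ/(θ² + ω²)`, the optimal interpolation error
`σ_h²(θ) = ∫ F_θ(ω)·(1 − F_θ(ω)/S_{θ,h}(ω)) dω`, where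
`S_{θ,h}(ω) = ∑_{k ∈ ℤ} F_θ(ω + k/h)`, satisfies `σ_h²(θ)/h → (2/3)π²θ` as `h → 0⁺`. -/
theorem interpolation_error_asymptotics (θ : ℝ) (hθ : 0 < θ) :
    Tendsto
      (fun h : ℝ =>
        (∫ ω : ℝ, θ / (θ ^ 2 + ω ^ 2) *
          (1 - (θ / (θ ^ 2 + ω ^ 2)) / ∑' k : ℤ, θ / (θ ^ 2 + (ω + (k : ℝ) / h) ^ 2))) / h)
      (𝓝[>] 0) (𝓝 (2 / 3 * π ^ 2 * θ)) := by
  have ha : Tendsto (fun h : ℝ => 2 * π * θ * h) (𝓝[>] 0) (𝓝[>] 0) := by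
    refine tendsto_nhdsWithin_iff.2 ⟨tendsto_nhdsWithin_of_tendsto_nhds ?_, ?_⟩
    · have : Continuous fun h : ℝ => 2 * π * θ * h := by fun_prop
      simpa using this.tendsto 0
    · filter_upwards [self_mem_nhdsWithin] with h hh
      have hh : 0 < h := hh
      show 0 < 2 * π * θ * h
      positivity
  have := (aux_lim.comp ha).const_mul (2 * π ^ 2 * θ)
  rw [show 2 / 3 * π ^ 2 * θ = 2 * π ^ 2 * θ * (1 / 3) by ring]
  refine this.congr' ?_
  filter_upwards [self_mem_nhdsWithin] with h hh
  have hh : 0 < h := hh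
  rw [aux_sigma θ h hθ hh]
  have hsinh : 0 < sinh (2 * π * θ * h) := Real.sinh_pos_iff.2 (by positivity)
  simp only [Function.comp]
  field_simp
end

section
/- Fix θ > 0 and θ' > 0, and define the misspecified interpolation error σ_h²(θ', θ) = ∫_ℝ F_θ(ω) · (1 − F_{θ'}(ω)/S_{θ',h}(ω)) dω, where F_θ(ω) = θ/(θ² + ω²) and S_{θ',h}(ω) = ∑_{k ∈ ℤ} F_{θ'}(ω + k/h). Then lim_{h → 0⁺} σ_h²(θ', θ)/h = (2/3) π² θ. In particular the leading-order interpolation error does not depend on the misspecified parameter θ'. -/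
open Real MeasureTheory Filter Topology

lemma aux_powexp (n : ℕ) {s : ℝ} (hs : 0 < s) :
    IntegrableOn (fun u : ℝ => u ^ n * exp (-(s * u))) (Set.Ioi 0) ∧
    ∫ u in Set.Ioi (0:ℝ), u ^ n * exp (-(s * u)) = n.factorial / s ^ (n + 1) := by
  constructor
  · have := integrableOn_rpow_mul_exp_neg_mul_rpow (p := 1) (s := n) (b := s)
      (by have : (0:ℝ) ≤ n := by positivity
          linarith) one_pos hs
    simpa using this
  · have := integral_rpow_mul_exp_neg_mul_Ioi (a := n + 1) (r := s) (by positivity) hs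
    rw [Real.Gamma_nat_eq_factorial] at this
    simp only [add_sub_cancel_right, rpow_natCast] at this
    rw [this, ← Nat.cast_add_one, rpow_natCast, one_div, inv_pow]
    field_simp

lemma aux_cosexp {s : ℝ} (hs : 0 < s) :
    IntegrableOn (fun u : ℝ => cos (2 * u) * exp (-(s * u))) (Set.Ioi 0) ∧
    ∫ u in Set.Ioi (0:ℝ), cos (2 * u) * exp (-(s * u)) = s / (s ^ 2 + 4) := by
  have hre : ((-s : ℂ) + 2 * Complex.I).re < 0 := by simpa using hs
  have h1 := integrableOn_exp_mul_complex_Ioi hre 0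
  have h2 := integral_exp_mul_complex_Ioi hre 0
  have e : ∀ u : ℝ, (Complex.exp (((-s : ℂ) + 2 * Complex.I) * u)).re
      = cos (2 * u) * exp (-(s * u)) := by
    intro u
    rw [Complex.exp_re]
    simp [mul_comm]
  constructor
  · have := h1.re
    simp only [RCLike.re_to_complex, e] at this
    exact this
  · have := integral_re h1
    simp only [RCLike.re_to_complex, e] at this
    rw [this, h2]
    simp [Complex.div_re, Complex.normSq_apply]
    ring

lemma aux_inner {s : ℝ} (hs : 0 < s) :
    IntegrableOn (fun u : ℝ => (u ^ 2 - sin u ^ 2) * (s ^ 3 / 6 * exp (-(s * u)))) (Set.Ioi 0) ∧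
    ∫ u in Set.Ioi (0:ℝ), (u ^ 2 - sin u ^ 2) * (s ^ 3 / 6 * exp (-(s * u)))
      = 4 / 3 / (s ^ 2 + 4) := by
  have e : ∀ u : ℝ, (u ^ 2 - sin u ^ 2) * (s ^ 3 / 6 * exp (-(s * u))) =
      s ^ 3 / 6 * ((u ^ 2 * exp (-(s * u)) - 1 / 2 * (u ^ 0 * exp (-(s * u)))) +
        1 / 2 * (cos (2 * u) * exp (-(s * u)))) := by
    intro u
    rw [sin_sq_eq_half_sub]; ring
  simp only [e]
  have h2 := aux_powexp 2 hs
  have h0 := aux_powexp 0 hs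
  have hc := aux_cosexp hs
  have i0 := h0.1.const_mul (1/2)
  have ic := hc.1.const_mul (1/2)
  have i2 : Integrable (fun u : ℝ => u ^ 2 * exp (-(s * u)) - 1 / 2 * (u ^ 0 * exp (-(s * u))))
    (volume.restrict (Set.Ioi 0)) := h2.1.sub i0
  refine ⟨((h2.1.sub i0).add ic).const_mul _, ?_⟩
  rw [integral_const_mul, integral_add i2 ic, integral_sub h2.1 i0,
    integral_const_mul, integral_const_mul, h2.2, h0.2, hc.2]
  simp [Nat.factorial]
  field_simp
  ring

lemma aux_outer : IntegrableOn (fun s : ℝ => 4 / 3 / (s ^ 2 + 4)) (Set.Ioi 0) ∧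
    ∫ s in Set.Ioi (0:ℝ), 4 / 3 / (s ^ 2 + 4) = π / 3 := by
  have e : ∀ s : ℝ, 4 / 3 / (s ^ 2 + 4) = 1 / 3 * (fun t : ℝ => (1 + t ^ 2)⁻¹) (2⁻¹ * s) := by
    intro s
    simp only
    field_simp
    ring
  simp only [e]
  constructor
  · exact ((integrable_inv_one_add_sq.comp_mul_left' (by norm_num : (2⁻¹:ℝ) ≠ 0)).const_mul _).integrableOn
  · rw [integral_const_mul, integral_comp_mul_left_Ioi (fun t : ℝ => (1 + t ^ 2)⁻¹) _ (by norm_num : (0:ℝ) < 2⁻¹), mul_zero,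
      integral_Ioi_inv_one_add_sq]
    simp
    ring

lemma aux_main : ∫ u in Set.Ioi (0:ℝ), (u ^ 2 - sin u ^ 2) / u ^ 4 = π / 3 := by
  have h1 : ∀ u ∈ Set.Ioi (0:ℝ), (u ^ 2 - sin u ^ 2) / u ^ 4 =
      ∫ s in Set.Ioi (0:ℝ), (u ^ 2 - sin u ^ 2) * (s ^ 3 / 6 * exp (-(s * u))) := by
    intro u hu
    have := (aux_powexp 3 hu).2
    rw [integral_const_mul]
    have e : ∀ s : ℝ, s ^ 3 / 6 * exp (-(s * u)) = 1 / 6 * (s ^ 3 * exp (-(u * s))) := by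
      intro s; rw [mul_comm u s]; ring
    simp only [e]
    rw [integral_const_mul, this]
    simp [Nat.factorial]
    field_simp
  rw [setIntegral_congr_fun measurableSet_Ioi h1, integral_integral_swap, ← aux_outer.2]
  · exact setIntegral_congr_fun measurableSet_Ioi (fun s hs => (aux_inner hs).2)
  · rw [integrable_prod_iff']
    · constructor
      · filter_upwards [ae_restrict_mem measurableSet_Ioi] with s hs
        exact (aux_inner hs).1
      · refine (integrable_congr ?_).mpr aux_outer.1
        filter_upwards [ae_restrict_mem measurableSet_Ioi] with s hs
        rw [← (aux_inner hs).2]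
        refine integral_congr_ae (Eventually.of_forall fun u => ?_)
        simp only [Function.uncurry]
        rw [Real.norm_of_nonneg]
        have : sin u ^ 2 ≤ u ^ 2 := sq_le_sq.mpr abs_sin_le_abs
        have hs' : (0:ℝ) < s := hs
        have := sub_nonneg.mpr this
        positivity
    · apply Continuous.aestronglyMeasurable
      unfold Function.uncurry
      fun_prop

lemma aux_limit_integral :
    ∫ x : ℝ, (1 - sin (π * x) ^ 2 / (π ^ 2 * x ^ 2)) / x ^ 2 = 2 / 3 * π ^ 2 := by
  have e : ∀ x : ℝ, (1 - sin (π * x) ^ 2 / (π ^ 2 * x ^ 2)) / x ^ 2 =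
      (fun y : ℝ => π ^ 2 * (fun u : ℝ => (u ^ 2 - sin u ^ 2) / u ^ 4) (π * y)) |x| := by
    intro x
    have hp := pi_pos.ne'
    have h : sin (π * |x|) ^ 2 = sin (π * x) ^ 2 := by
      rcases abs_choice x with h | h <;> rw [h]
      rw [mul_neg, sin_neg, neg_sq]
    simp only [mul_pow, h, sq_abs, (by decide : Even 4).pow_abs]
    by_cases hx : x = 0
    · simp [hx]
    · field_simp
  simp only [e]
  rw [integral_comp_abs (f := fun y : ℝ => π ^ 2 * (fun u : ℝ => (u ^ 2 - sin u ^ 2) / u ^ 4) (π * y)),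
    integral_const_mul, integral_comp_mul_left_Ioi (fun u : ℝ => (u ^ 2 - sin u ^ 2) / u ^ 4) _ pi_pos, mul_zero, aux_main]
  have hp := pi_pos.ne'
  simp
  field_simp

lemma aux_im_inv (a x : ℝ) (n : ℝ) :
    (1 / (((x:ℂ) + a * Complex.I) + n)).im = - (a / (a ^ 2 + (x + n) ^ 2)) := by
  simp [Complex.div_im, Complex.normSq_apply]
  ring

lemma aux_im_cot (a x : ℝ) (ha : 0 < a) :
    (Complex.cot (π * ((x:ℂ) + a * Complex.I))).im =
      - (sinh (2 * π * a) / (cosh (2 * π * a) - cos (2 * π * x))) := by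
  have e : (π * ((x:ℂ) + a * Complex.I)) = ((π * x : ℝ) : ℂ) + ((π * a : ℝ) : ℂ) * Complex.I := by
    push_cast; ring
  have hs : 0 < sinh (π * a) := sinh_pos_iff.mpr (by positivity)
  rw [Complex.cot, e, Complex.sin_add_mul_I, Complex.cos_add_mul_I]
  simp only [← Complex.ofReal_sin, ← Complex.ofReal_cos, ← Complex.ofReal_sinh,
    ← Complex.ofReal_cosh]
  rw [show 2 * π * a = 2 * (π * a) by ring, show 2 * π * x = 2 * (π * x) by ring,
    sinh_two_mul, cosh_two_mul, cos_two_mul']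
  have h1 := sin_sq_add_cos_sq (π * x)
  have h2 := cosh_sq (π * a)
  have hd : 0 < sin (π * x) ^ 2 * cosh (π * a) ^ 2 + cos (π * x) ^ 2 * sinh (π * a) ^ 2 := by
    rw [h2]; nlinarith [sq_nonneg (sin (π * x)), pow_pos hs 2]
  have hd2 : cosh (π * a) ^ 2 + sinh (π * a) ^ 2 - (cos (π * x) ^ 2 - sin (π * x) ^ 2)
     = 2 * (sin (π * x) ^ 2 * cosh (π * a) ^ 2 + cos (π * x) ^ 2 * sinh (π * a) ^ 2) := by
    rw [h2]; linear_combination (-1 - 2 * sinh (π*a)^2) * h1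
  rw [hd2]
  generalize sin (π * x) = S at *
  generalize cos (π * x) = C at *
  generalize sinh (π * a) = T at *
  generalize cosh (π * a) = D at *
  have hd3 : (S * D) * (S * D) + (C * T) * (C * T) = S ^ 2 * D ^ 2 + C ^ 2 * T ^ 2 := by ring
  simp [Complex.div_im, Complex.normSq_apply]
  rw [hd3, ← sub_div, ← neg_div, div_eq_div_iff hd.ne' (by positivity)]
  linear_combination (-2 * T * D * (S ^ 2 * D ^ 2 + C ^ 2 * T ^ 2)) * h1

lemma aux_hasSum (a x : ℝ) (ha : 0 < a) :
    Summable (fun k : ℤ => a / (a ^ 2 + (x + k) ^ 2)) ∧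
    ∑' k : ℤ, a / (a ^ 2 + (x + k) ^ 2) =
      π * sinh (2 * π * a) / (cosh (2 * π * a) - cos (2 * π * x)) := by
  set z : ℂ := (x:ℂ) + a * Complex.I with hz
  have hzim : 0 < z.im := by simpa [hz] using ha
  have hzc : z ∈ Complex.integerComplement := UpperHalfPlane.coe_mem_integerComplement ⟨z, hzim⟩
  have hsum := (summable_cotTerm hzc).hasSum
  have hval := cot_series_rep' hzc
  set f : ℤ → ℝ := fun k => a / (a ^ 2 + (x + k) ^ 2) with hf
  have hpos : ∀ k, 0 ≤ f k := fun k => by positivity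
  have hterm : ∀ n : ℕ, (cotTerm z n).im = -(f (n + 1) + f (-(n + 1))) := by
    intro n
    have h1 := aux_im_inv a x (n + 1)
    have h2 := aux_im_inv a x (-(n + 1))
    rw [← hz] at h1 h2
    push_cast at h1 h2
    rw [← sub_eq_add_neg] at h2
    simp only [cotTerm, Complex.add_im, h1, h2, hf]
    push_cast
    ring
  have him := Complex.hasSum_im hsum
  simp only [hterm] at him
  have him2 := him.neg
  simp only [neg_neg] at him2
  have s1 : Summable (fun n : ℕ => f (n + 1)) :=
    him2.summable.of_nonneg_of_le (fun n => hpos _) (fun n => le_add_of_nonneg_right (hpos _))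
  have s2 : Summable (fun n : ℕ => f (-(n + 1))) :=
    him2.summable.of_nonneg_of_le (fun n => hpos _) (fun n => le_add_of_nonneg_left (hpos _))
  have key := s1.hasSum.of_add_one_of_neg_add_one s2.hasSum
  refine ⟨key.summable, ?_⟩
  rw [key.tsum_eq]
  have e1 := (s1.hasSum.add s2.hasSum).unique him2
  have e2 : (∑' n : ℕ, cotTerm z n) = π * Complex.cot (π * z) - 1 / z := hval.symm
  have e3 := aux_im_inv a x 0
  rw [← hz] at e3
  rw [e2, Complex.sub_im, Complex.im_ofReal_mul, aux_im_cot a x ha] at e1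
  simp only [Complex.ofReal_zero, add_zero] at e3
  rw [e3] at e1
  have e4 : f 0 = a / (a ^ 2 + x ^ 2) := by simp [hf]
  rw [e4]
  linear_combination e1

/-- The error factor in rescaled variables. -/
noncomputable def auxG (a x : ℝ) : ℝ :=
  1 - (a / (a ^ 2 + x ^ 2)) / (π * sinh (2 * π * a) / (cosh (2 * π * a) - cos (2 * π * x)))

lemma aux_T_ge (a x : ℝ) (ha : 0 < a) :
    a / (a ^ 2 + x ^ 2) ≤ π * sinh (2 * π * a) / (cosh (2 * π * a) - cos (2 * π * x)) := by
  obtain ⟨h1, h2⟩ := aux_hasSum a x ha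
  rw [← h2]
  have := h1.le_tsum 0 (fun k _ => by positivity)
  simpa using this

lemma auxG_nonneg (a x : ℝ) (ha : 0 < a) : 0 ≤ auxG a x := by
  have h := aux_T_ge a x ha
  have hp : 0 < a / (a ^ 2 + x ^ 2) := by positivity
  rw [auxG, sub_nonneg]
  exact (div_le_one (hp.trans_le h)).mpr h

lemma auxG_le_one (a x : ℝ) (ha : 0 < a) : auxG a x ≤ 1 := by
  have h := aux_T_ge a x ha
  have hp : 0 < a / (a ^ 2 + x ^ 2) := by positivity
  rw [auxG, sub_le_self_iff]
  exact div_nonneg hp.le (hp.le.trans h)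

lemma auxG_le : ∃ C : ℝ, 0 < C ∧ ∀ a x : ℝ, 0 < a → |x| ≤ 1 / 2 →
    auxG a x ≤ C * (a ^ 2 + x ^ 2) := by
  have hs : Summable (fun k : ℤ => 1 / (k : ℝ) ^ 2) := Real.summable_one_div_int_pow.mpr one_lt_two
  have hC0 : 0 ≤ ∑' k : ℤ, 1 / (k : ℝ) ^ 2 := tsum_nonneg fun k => by positivity
  refine ⟨4 * (∑' k : ℤ, 1 / (k : ℝ) ^ 2) + 1, by positivity, fun a x ha hx => ?_⟩
  obtain ⟨h1, h2⟩ := aux_hasSum a x ha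
  have h := aux_T_ge a x ha
  have hp : 0 < a / (a ^ 2 + x ^ 2) := by positivity
  have hle : π * sinh (2 * π * a) / (cosh (2 * π * a) - cos (2 * π * x)) ≤
      a / (a ^ 2 + x ^ 2) + (4 * a) * ∑' k : ℤ, 1 / (k : ℝ) ^ 2 := by
    rw [← h2]
    refine hasSum_le ?_ h1.hasSum
      ((hasSum_ite_eq (0 : ℤ) (a / (a ^ 2 + x ^ 2))).add (hs.hasSum.mul_left (4 * a)))
    intro k
    by_cases hk : k = 0
    · simp [hk]
    · have hk1 : (1:ℝ) ≤ |(k:ℝ)| := by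
        have := Int.one_le_abs hk
        exact_mod_cast this
      have hk2 : |(k:ℝ)| / 2 ≤ |x + k| := by
        have := abs_sub_abs_le_abs_add (k:ℝ) x
        rw [add_comm (k:ℝ) x] at this
        linarith
      have hk3 : (k:ℝ) ^ 2 / 4 ≤ (x + k) ^ 2 := by
        rw [← sq_abs (k:ℝ), ← sq_abs (x + k)]
        nlinarith
      have hk4 : 0 < (k:ℝ) ^ 2 := by positivity
      simp only [hk, if_false, zero_add]
      rw [mul_one_div, div_le_div_iff₀ (by positivity) hk4]
      nlinarith [pow_pos ha 3]
  unfold auxG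
  set T := π * sinh (2 * π * a) / (cosh (2 * π * a) - cos (2 * π * x))
  set F := a / (a ^ 2 + x ^ 2) with hF
  have hT : 0 < T := hp.trans_le h
  calc 1 - F / T = (T - F) / T := by field_simp
    _ ≤ (T - F) / F := div_le_div_of_nonneg_left (by linarith) hp h
    _ ≤ (4 * a * ∑' k : ℤ, 1 / (k : ℝ) ^ 2) / F := by gcongr; linarith
    _ = (4 * ∑' k : ℤ, 1 / (k : ℝ) ^ 2) * (a ^ 2 + x ^ 2) := by rw [hF]; field_simp
    _ ≤ _ := by nlinarith [sq_nonneg a, sq_nonneg x]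

lemma auxG_tendsto (x : ℝ) (hx : x ≠ 0) :
    Tendsto (fun a => auxG a x) (𝓝[>] 0) (𝓝 (1 - sin (π * x) ^ 2 / (π ^ 2 * x ^ 2))) := by
  have hsl : Tendsto (fun a : ℝ => sinh (2 * π * a) / a) (𝓝[>] 0) (𝓝 (2 * π)) := by
    have hd : HasDerivAt (fun a : ℝ => sinh (2 * π * a)) (2 * π) 0 := by
      have := ((hasDerivAt_id (0:ℝ)).const_mul (2 * π)).sinh
      simpa using this
    have := hd.tendsto_slope_zero_right
    refine this.congr fun t => ?_
    simp [div_eq_inv_mul]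
  have hc : Tendsto (fun a : ℝ => (cosh (2 * π * a) - cos (2 * π * x)) / (π * (a ^ 2 + x ^ 2)))
      (𝓝[>] 0) (𝓝 ((cosh (2 * π * 0) - cos (2 * π * x)) / (π * (0 ^ 2 + x ^ 2)))) := by
    apply tendsto_nhdsWithin_of_tendsto_nhds
    apply ContinuousAt.tendsto (f := fun a : ℝ =>
      (cosh (2 * π * a) - cos (2 * π * x)) / (π * (a ^ 2 + x ^ 2)))
    apply ContinuousAt.div (by fun_prop) (by fun_prop)
    have := pi_pos
    positivity
  have hp := pi_pos
  have := (hc.div hsl (by positivity)).const_sub 1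
  have e : 1 - (cosh (2 * π * 0) - cos (2 * π * x)) / (π * (0 ^ 2 + x ^ 2)) / (2 * π) =
      1 - sin (π * x) ^ 2 / (π ^ 2 * x ^ 2) := by
    rw [show 2 * π * x = 2 * (π * x) by ring, cos_two_mul, cos_sq', mul_zero, cosh_zero]
    field_simp
    ring
  rw [e] at this
  refine this.congr' ?_
  filter_upwards [self_mem_nhdsWithin] with a ha
  have ha' : (0:ℝ) < a := ha
  have hs : 0 < sinh (2 * π * a) := sinh_pos_iff.mpr (by positivity)
  simp only [auxG, Pi.div_apply]
  congr 1
  by_cases hz : cosh (2 * π * a) - cos (2 * π * x) = 0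
  · simp [hz]
  · field_simp

lemma aux_rescale (θ θ' h : ℝ) (hθ' : 0 < θ') (hh : 0 < h) :
    (∫ ω : ℝ, θ / (θ ^ 2 + ω ^ 2) *
          (1 - (θ' / (θ' ^ 2 + ω ^ 2)) / ∑' k : ℤ, θ' / (θ' ^ 2 + (ω + (k : ℝ) / h) ^ 2))) / h =
    ∫ x : ℝ, θ / ((θ * h) ^ 2 + x ^ 2) * auxG (h * θ') x := by
  set f : ℝ → ℝ := fun ω => θ / (θ ^ 2 + ω ^ 2) *
    (1 - (θ' / (θ' ^ 2 + ω ^ 2)) / ∑' k : ℤ, θ' / (θ' ^ 2 + (ω + (k : ℝ) / h) ^ 2)) with hf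
  have h1 := Measure.integral_comp_div f h
  rw [abs_of_pos hh, smul_eq_mul] at h1
  have h2 : ∀ x, θ / ((θ * h) ^ 2 + x ^ 2) * auxG (h * θ') x = (h ^ 2)⁻¹ * f (x / h) := by
    intro x
    have ha : 0 < h * θ' := by positivity
    have e1 : ∀ y : ℝ, θ' / (θ' ^ 2 + (y / h) ^ 2) = h * (h * θ' / ((h * θ') ^ 2 + y ^ 2)) := by
      intro y
      have : 0 < (h * θ') ^ 2 + y ^ 2 := by positivity
      field_simp
    have e2 : θ / (θ ^ 2 + (x / h) ^ 2) = h ^ 2 * (θ / ((θ * h) ^ 2 + x ^ 2)) := by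
      have : θ ^ 2 + (x / h) ^ 2 = ((θ * h) ^ 2 + x ^ 2) / h ^ 2 := by field_simp
      rw [this, div_div_eq_mul_div]
      ring
    simp only [hf, ← add_div, e1, e2, tsum_mul_left, (aux_hasSum (h * θ') x ha).2]
    rw [mul_div_mul_left _ _ hh.ne', auxG]
    field_simp
  simp only [h2]
  rw [integral_const_mul, h1]
  field_simp

/-- Paper's Corollary 3: for the exponential (Matérn `ν = 1/2`) spectral densities
`F_θ(ω) = θ/(θ² + ω²)`, the misspecified interpolation error
`σ_h²(θ', θ) = ∫ F_θ(ω)·(1 − F_{θ'}(ω)/S_{θ',h}(ω)) dω`, where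
`S_{θ',h}(ω) = ∑_{k ∈ ℤ} F_{θ'}(ω + k/h)`, satisfies `σ_h²(θ', θ)/h → (2/3)π²θ` as
`h → 0⁺`; in particular the leading-order error does not depend on `θ'`. -/
theorem misspecified_interpolation_error_asymptotics (θ θ' : ℝ) (hθ : 0 < θ) (hθ' : 0 < θ') :
    Tendsto
      (fun h : ℝ =>
        (∫ ω : ℝ, θ / (θ ^ 2 + ω ^ 2) *
          (1 - (θ' / (θ' ^ 2 + ω ^ 2)) / ∑' k : ℤ, θ' / (θ' ^ 2 + (ω + (k : ℝ) / h) ^ 2))) / h)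
      (𝓝[>] 0) (𝓝 (2 / 3 * π ^ 2 * θ)) := by
  obtain ⟨C, hC, hG⟩ := auxG_le
  have hev : ∀ᶠ h : ℝ in 𝓝[>] 0, 0 < h := self_mem_nhdsWithin
  have hlim : 2 / 3 * π ^ 2 * θ =
      ∫ x : ℝ, θ * ((1 - sin (π * x) ^ 2 / (π ^ 2 * x ^ 2)) / x ^ 2) := by
    rw [integral_const_mul, aux_limit_integral]; ring
  rw [hlim]
  have hmain : Tendsto (fun h : ℝ => ∫ x : ℝ, θ / ((θ * h) ^ 2 + x ^ 2) * auxG (h * θ') x)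
      (𝓝[>] 0) (𝓝 (∫ x : ℝ, θ * ((1 - sin (π * x) ^ 2 / (π ^ 2 * x ^ 2)) / x ^ 2))) := by
    set K : ℝ := 2 * (θ * (C * (1 + θ' ^ 2 / θ ^ 2))) + 5 * θ with hK
    refine tendsto_integral_filter_of_dominated_convergence (fun x => K * (1 + x ^ 2)⁻¹)
      ?_ ?_ (integrable_inv_one_add_sq.const_mul _) ?_
    · filter_upwards with h
      apply Measurable.aestronglyMeasurable
      unfold auxG
      fun_prop
    · filter_upwards [hev] with h hh
      filter_upwards with x
      have ha : 0 < h * θ' := by positivity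
      have g0 := auxG_nonneg (h * θ') x ha
      have g1 := auxG_le_one (h * θ') x ha
      have hden : 0 < (θ * h) ^ 2 + x ^ 2 := by positivity
      rw [Real.norm_of_nonneg (by positivity), ← div_eq_mul_inv, le_div_iff₀ (by positivity)]
      have hb1 : 0 < θ * (C * (1 + θ' ^ 2 / θ ^ 2)) := by positivity
      by_cases hx : |x| ≤ 1 / 2
      · have g2 := hG (h * θ') x ha hx
        have hx2 : x ^ 2 ≤ 1 := by
          rw [← sq_abs]; nlinarith [abs_nonneg x]
        have hb : θ / ((θ * h) ^ 2 + x ^ 2) * auxG (h * θ') x ≤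
            θ * (C * (1 + θ' ^ 2 / θ ^ 2)) := by
          calc _ ≤ θ / ((θ * h) ^ 2 + x ^ 2) * (C * ((h * θ') ^ 2 + x ^ 2)) := by gcongr
            _ = θ * C * (((h * θ') ^ 2 + x ^ 2) / ((θ * h) ^ 2 + x ^ 2)) := by ring
            _ ≤ θ * C * (1 + θ' ^ 2 / θ ^ 2) := by
              gcongr
              rw [div_le_iff₀ hden]
              have : (1 + θ' ^ 2 / θ ^ 2) * ((θ * h) ^ 2 + x ^ 2) =
                (θ * h) ^ 2 + x ^ 2 + (h * θ') ^ 2 + θ' ^ 2 / θ ^ 2 * x ^ 2 := by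
                field_simp
                ring
              rw [this]
              have : 0 ≤ θ' ^ 2 / θ ^ 2 * x ^ 2 := by positivity
              nlinarith [sq_nonneg (θ * h)]
            _ = _ := by ring
        calc _ ≤ θ * (C * (1 + θ' ^ 2 / θ ^ 2)) * (1 + x ^ 2) := by gcongr
          _ ≤ K := by nlinarith
      · have hx2 : 1 / 4 < x ^ 2 := by
          rw [← sq_abs]; nlinarith [not_le.mp hx]
        have hb : θ / ((θ * h) ^ 2 + x ^ 2) * auxG (h * θ') x ≤ θ / x ^ 2 := by
          calc _ ≤ θ / ((θ * h) ^ 2 + x ^ 2) * 1 := by gcongr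
            _ ≤ θ / x ^ 2 := by
              rw [mul_one]; gcongr; nlinarith [sq_nonneg (θ * h)]
        calc _ ≤ θ / x ^ 2 * (1 + x ^ 2) := by gcongr
          _ ≤ 5 * θ := by
            rw [div_mul_eq_mul_div, div_le_iff₀ (by linarith)]
            nlinarith
          _ ≤ K := by linarith
    · have h0 : ∀ᵐ x : ℝ, x ≠ 0 := by simp [ae_iff, measure_singleton]
      filter_upwards [h0] with x hx
      have t1 : Tendsto (fun h : ℝ => h * θ') (𝓝[>] 0) (𝓝[>] 0) := by
        refine tendsto_nhdsWithin_iff.mpr ⟨?_, ?_⟩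
        · apply tendsto_nhdsWithin_of_tendsto_nhds
          have : ContinuousAt (fun h : ℝ => h * θ') 0 := by fun_prop
          simpa [ContinuousAt] using this
        · filter_upwards [hev] with h hh
          exact mul_pos hh hθ'
      have t2 := (auxG_tendsto x hx).comp t1
      have t3 : Tendsto (fun h : ℝ => θ / ((θ * h) ^ 2 + x ^ 2)) (𝓝[>] 0) (𝓝 (θ / x ^ 2)) := by
        apply tendsto_nhdsWithin_of_tendsto_nhds
        have : ContinuousAt (fun h : ℝ => θ / ((θ * h) ^ 2 + x ^ 2)) 0 := by
          apply ContinuousAt.div (by fun_prop) (by fun_prop)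
          positivity
        simpa [ContinuousAt] using this
      have t4 := t3.mul t2
      rw [show θ * ((1 - sin (π * x) ^ 2 / (π ^ 2 * x ^ 2)) / x ^ 2) =
        θ / x ^ 2 * (1 - sin (π * x) ^ 2 / (π ^ 2 * x ^ 2)) by ring]
      exact t4
  refine hmain.congr' ?_
  filter_upwards [hev] with h hh
  exact (aux_rescale θ θ' h hθ' hh).symm
end
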